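/- arXiv:math/0607074 — 2 statements merged into one kernel-verified Lean document; each statement's English description precedes it below -/
import Mathlib

section
/- Let K be a field of characteristic zero, and fix n ≥ 1, k ≥ 1, d ≥ 1 and a tensor type (p,q), V = T^p_q. Then there exist finitely many tensor types (p_i,q_i), with W_i = T^{p_i}_{q_i}, and JGL^{k+1}(n)-equivariant polynomial maps δ_i : J^k V → W_i whose degree in the positive-order components ⊕_{l=1}^k Sym^l(K^n)^* ⊗ V is at most d, with the following property: for every tensor type (p',q'), W = T^{p'}_{q'}, every JGL^{k+1}(n)-equivariant polynomial map δ : J^k V → W of degree ≤ d in the positive-order components can be written δ(v) = Σ_{i,s} Φ_{i,s}(δ_i(v) ⊗ v_0^{⊗s}), a finite sum in which each Φ_{i,s} : W_i ⊗ Sym^s V → W is a GL(n,K)-equivariant linear map, v_0 ∈ V denotes the order-zero component of v ∈ J^k V, and v_0^{⊗s} its image in Sym^s V. -/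
open MvPolynomial

open scoped Classical

/-- Index type for coordinates of the tensor space `T^p_q`. -/
abbrev TIdx (n p q : ℕ) := (Fin p → Fin n) × (Fin q → Fin n)

/-- Type-`(p,q)` tensor fields on `K^n` with polynomial coefficients; those with
coefficients of total degree `≤ k` realize the jet space `J^k T^p_q`. -/
abbrev TField (K : Type) [Field K] (n p q : ℕ) := TIdx n p q → MvPolynomial (Fin n) K

/-- Constant type-`(p,q)` tensors. -/
abbrev TConst (K : Type) [Field K] (n p q : ℕ) := TIdx n p q → K

/-- The `GL_n` transformation weight on `T^p_q` (`Ai` stands for `A⁻¹`). -/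
def wtK {K : Type} [Field K] {n p q : ℕ} (A Ai : Matrix (Fin n) (Fin n) K)
    (IJ IJ' : TIdx n p q) : K :=
  (∏ s, A (IJ.1 s) (IJ'.1 s)) * ∏ t, Ai (IJ'.2 t) (IJ.2 t)

/-- The `GL_n`-action on constant tensors `T^p_q`. -/
noncomputable def kAct {K : Type} [Field K] {n p q : ℕ}
    (A Ai : Matrix (Fin n) (Fin n) K) (w : TConst K n p q) : TConst K n p q :=
  fun IJ => ∑ IJ' : TIdx n p q, wtK A Ai IJ IJ' * w IJ'

/-- Truncation of a polynomial: sum of homogeneous components of degree `≤ k`. -/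
noncomputable def truncP {K : Type} [Field K] {N : ℕ} (k : ℕ)
    (f : MvPolynomial (Fin N) K) : MvPolynomial (Fin N) K :=
  ∑ d ∈ Finset.range (k + 1), homogeneousComponent d f

/-- `g, h` are mutually inverse `(k+1)`-jets of diffeomorphisms of `K^n` fixing `0`
(elements of the jet group `JGL^{k+1}(n)`). -/
def JetPair (K : Type) [Field K] (n k : ℕ)
    (g h : Fin n → MvPolynomial (Fin n) K) : Prop :=
  (∀ i, constantCoeff (g i) = 0) ∧ (∀ i, constantCoeff (h i) = 0) ∧
  (∀ i, truncP (k + 1) (bind₁ h (g i)) = X i) ∧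
  (∀ i, truncP (k + 1) (bind₁ g (h i)) = X i)

/-- The pushforward action of a jet `g` (with inverse jet `h`) on polynomial tensor fields:
`(g·v)(x) = ρ(Dg(g⁻¹(x))) v(g⁻¹(x))`, truncated to coefficient degree `≤ k`. -/
noncomputable def push (K : Type) [Field K] (n k p q : ℕ)
    (g h : Fin n → MvPolynomial (Fin n) K) (v : TField K n p q) : TField K n p q :=
  fun IJ => truncP k (∑ IJ' : TIdx n p q,
    (∏ s, bind₁ h (pderiv (IJ'.1 s) (g (IJ.1 s)))) *
    (∏ t, pderiv (IJ.2 t) (h (IJ'.2 t))) * bind₁ h (v IJ'))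

/-- The Jacobian matrix at `0` of a polynomial map. -/
noncomputable def Dmat0 (K : Type) [Field K] (n : ℕ)
    (g : Fin n → MvPolynomial (Fin n) K) : Matrix (Fin n) (Fin n) K :=
  Matrix.of fun i j => constantCoeff (pderiv j (g i))

/-- The coordinates of `J^k V`, `V = T^p_q`. -/
abbrev CIdx (n p q k : ℕ) := TIdx n p q × {m : Fin n →₀ ℕ // (m.sum fun _ e => e) ≤ k}

/-- The polynomial map `J^k V → W` with coordinate polynomials `F`. -/
noncomputable def evalPoly {K : Type} [Field K] {n p q k p' q' : ℕ}
    (F : TIdx n p' q' → MvPolynomial (CIdx n p q k) K) (v : TField K n p q) :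
    TConst K n p' q' :=
  fun κ => eval (fun s : CIdx n p q k => (v s.1).coeff s.2.1) (F κ)

/-- `δ = evalPoly F` has degree `≤ d` in the positive-order components
`⊕_{l=1}^k Sym^l (K^n)^* ⊗ V` of `J^k V`. -/
def PosDegLE {K : Type} [Field K] (n p q k p' q' d : ℕ)
    (F : TIdx n p' q' → MvPolynomial (CIdx n p q k) K) : Prop :=
  ∀ κ, ∀ m ∈ (F κ).support,
    (∑ s ∈ m.support.filter (fun s : CIdx n p q k => s.2.1 ≠ 0), m s) ≤ d

/-- `JGL^{k+1}(n)`-equivariance of a map `J^k V → W` (on fields of coefficient degree `≤ k`):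
`δ(g·v) = ρ_W(Dg(0)) δ(v)`. -/
def IsJetEquivariant (K : Type) [Field K] (n k p q p' q' : ℕ)
    (δ : TField K n p q → TConst K n p' q') : Prop :=
  ∀ g h : Fin n → MvPolynomial (Fin n) K, JetPair K n k g h →
    ∀ v : TField K n p q, (∀ idx, (v idx).totalDegree ≤ k) →
      δ (push K n k p q g h v) = kAct (Dmat0 K n g) (Dmat0 K n h) (δ v)

/-- The `GL_n`-action on the tensor product `W_i ⊗ V^{⊗s}` in coordinates. -/
noncomputable def cAct {K : Type} [Field K] {n pi qi p q s : ℕ}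
    (A Ai : Matrix (Fin n) (Fin n) K)
    (u : (TIdx n pi qi × (Fin s → TIdx n p q)) → K) :
    (TIdx n pi qi × (Fin s → TIdx n p q)) → K :=
  fun x => ∑ κ' : TIdx n pi qi, ∑ f' : Fin s → TIdx n p q,
    wtK A Ai x.1 κ' * (∏ j, wtK A Ai (x.2 j) (f' j)) * u (κ', f')

/-- The element `w ⊗ v_0^{⊗s} ∈ W_i ⊗ Sym^s V ⊆ W_i ⊗ V^{⊗s}` in coordinates. -/
def elemT {K : Type} [Field K] {n pi qi p q : ℕ}
    (w : TConst K n pi qi) (v0 : TConst K n p q) (s : ℕ) :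
    (TIdx n pi qi × (Fin s → TIdx n p q)) → K :=
  fun x => w x.1 * ∏ j, v0 (x.2 j)

section Reynolds

open Matrix

/-- For a rational matrix `B`, the kernel of `Bᵀ * B` is the image of a polynomial in `Bᵀ * B`
with constant coefficient one. -/
theorem exists_polynomial_mul_aeval_eq_zero {I J : Type*} [Fintype I] [DecidableEq I] [Fintype J]
    (B : Matrix J I ℚ) :
    ∃ r : Polynomial ℚ, B * (1 + Polynomial.aeval (Bᵀ * B) r * (Bᵀ * B)) = 0 := by
  set a : Matrix I I ℚ := Bᵀ * B with ha
  have hB : ∀ N : Matrix I I ℚ, a * N = 0 → B * N = 0 := by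
    intro N hN
    rw [ha, ← conjTranspose_eq_transpose_of_trivial] at hN
    exact (conjTranspose_mul_self_mul_eq_zero B N).1 hN
  have haT : aᵀ = a := by rw [ha, transpose_mul, transpose_transpose]
  have hsq : ∀ N : Matrix I I ℚ, a * (a * N) = 0 → a * N = 0 := by
    intro N hN
    have h : aᴴ * a * N = 0 := by
      rw [conjTranspose_eq_transpose_of_trivial, haT, Matrix.mul_assoc, hN]
    exact (conjTranspose_mul_self_mul_eq_zero a N).1 h
  have hpow : ∀ (m : ℕ) (N : Matrix I I ℚ), a ^ m * N = 0 → a * N = 0 := by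
    intro m
    induction m with
    | zero => intro N hN; rw [pow_zero, Matrix.one_mul] at hN; rw [hN, Matrix.mul_zero]
    | succ m ih =>
      intro N hN
      rw [pow_succ, Matrix.mul_assoc] at hN
      exact hsq N (ih _ hN)
  have hmin : minpoly ℚ a ≠ 0 := minpoly.ne_zero (Algebra.IsIntegral.isIntegral a)
  obtain ⟨f, hf, hfd⟩ :=
    Polynomial.exists_eq_pow_rootMultiplicity_mul_and_not_dvd (minpoly ℚ a) hmin 0
  have hf0 : f.coeff 0 ≠ 0 := by
    intro h
    apply hfd
    rw [Polynomial.C_0, sub_zero]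
    exact Polynomial.X_dvd_iff.2 h
  have hzero : a * Polynomial.aeval a f = 0 := by
    apply hpow ((minpoly ℚ a).rootMultiplicity 0)
    have := minpoly.aeval ℚ a
    rw [hf] at this
    simpa using this
  refine ⟨Polynomial.C (f.coeff 0)⁻¹ * f.divX, hB _ ?_⟩
  have h1 : Polynomial.C (f.coeff 0)⁻¹ * f =
      1 + Polynomial.C (f.coeff 0)⁻¹ * f.divX * Polynomial.X := by
    have h : Polynomial.C (f.coeff 0)⁻¹ * Polynomial.C (f.coeff 0) = 1 := by
      rw [← Polynomial.C_mul, inv_mul_cancel₀ hf0, Polynomial.C_1]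
    linear_combination h - Polynomial.C (f.coeff 0)⁻¹ * f.divX_mul_X_add
  have h2 : 1 + Polynomial.aeval a (Polynomial.C (f.coeff 0)⁻¹ * f.divX) * a
      = (f.coeff 0)⁻¹ • Polynomial.aeval a f := by
    have := congrArg (Polynomial.aeval a) h1
    simp only [map_add, map_one, map_mul, Polynomial.aeval_X, Polynomial.aeval_C] at this ⊢
    rw [← this, Algebra.smul_def]
  rw [h2, Matrix.mul_smul, hzero, smul_zero]

/-- A joint fixed space of endomorphisms of a finite-dimensional space is already cut out by
finitely many of them. -/
theorem exists_finset_fixed_of_forall {K : Type*} [Field K] {I S : Type*} [Fintype I]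
    (N : S → Matrix I I K) :
    ∃ T : Finset S, ∀ y : I → K, (∀ s ∈ T, N s *ᵥ y = y) → ∀ s, N s *ᵥ y = y := by
  classical
  let Z : Finset S → Submodule K (I → K) := fun T =>
    { carrier := {y | ∀ s ∈ T, N s *ᵥ y = y}
      add_mem' := fun {y z} hy hz s hs => by rw [mulVec_add, hy s hs, hz s hs]
      zero_mem' := fun s _ => mulVec_zero _
      smul_mem' := fun c y hy s hs => by rw [mulVec_smul, hy s hs] }
  obtain ⟨_, ⟨T, rfl⟩, hT⟩ := IsArtinian.set_has_minimal (Set.range Z) ⟨_, ⟨∅, rfl⟩⟩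
  refine ⟨T, fun y hy s => ?_⟩
  have hle : Z (insert s T) ≤ Z T := fun y hy t ht => hy t (Finset.mem_insert_of_mem ht)
  have hmem : y ∈ Z (insert s T) := by
    by_contra hn
    exact hT _ ⟨_, rfl⟩ (lt_of_le_of_ne hle fun h => hn (h ▸ hy))
  exact hmem s (Finset.mem_insert_self _ _)

/-- Existence of a fixed vector in an affine subspace `x + L`, for a transpose-stable family of
rational matrices preserving `x + L`. -/
theorem exists_fixed_of_transpose_stable {K : Type*} [Field K] [CharZero K] {I S : Type*}
    [Fintype I] (M : S → Matrix I I ℚ) (L : Submodule K (I → K))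
    (hL : ∀ s, ∀ x ∈ L, (M s).map (algebraMap ℚ K) *ᵥ x ∈ L)
    (hLT : ∀ s, ∀ x ∈ L, (M s)ᵀ.map (algebraMap ℚ K) *ᵥ x ∈ L)
    (x : I → K) (hx : ∀ s, (M s).map (algebraMap ℚ K) *ᵥ x - x ∈ L) :
    ∃ y, y - x ∈ L ∧ ∀ s, (M s).map (algebraMap ℚ K) *ᵥ y = y := by
  classical
  obtain ⟨T, hT⟩ := exists_finset_fixed_of_forall fun s => (M s).map (algebraMap ℚ K)
  let B : Matrix (T × I) I ℚ := Matrix.of fun s j => (M s.1 - 1) s.2 j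
  obtain ⟨r, hr⟩ := exists_polynomial_mul_aeval_eq_zero B
  set a := Bᵀ * B with ha
  let φ : Matrix I I ℚ →+* Matrix I I K := (algebraMap ℚ K).mapMatrix
  have haS : a = ∑ s : T, (M s - 1)ᵀ * (M s - 1) := by
    ext i j
    simp only [ha, mul_apply, Fintype.sum_prod_type, Matrix.sum_apply]
    rfl
  have hsub : ∀ s z, φ (M s - 1) *ᵥ z = (M s).map (algebraMap ℚ K) *ᵥ z - z := by
    intro s z
    rw [map_sub, map_one, sub_mulVec, one_mulVec]
    rfl
  have hsubT : ∀ s, ∀ z ∈ L, φ (M s - 1)ᵀ *ᵥ z ∈ L := by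
    intro s z hz
    rw [transpose_sub, transpose_one, map_sub, map_one, sub_mulVec, one_mulVec]
    exact L.sub_mem (hLT s z hz) hz
  have haφ : ∀ z, φ a *ᵥ z = ∑ s : T, φ (M s - 1)ᵀ *ᵥ (φ (M s - 1) *ᵥ z) := by
    intro z
    rw [haS, map_sum, sum_mulVec]
    exact Finset.sum_congr rfl fun s _ => by rw [map_mul, mulVec_mulVec]
  have haL : ∀ z ∈ L, φ a *ᵥ z ∈ L := by
    intro z hz
    rw [haφ]
    refine L.sum_mem fun s _ => hsubT _ _ ?_
    rw [hsub]
    exact L.sub_mem (hL s z hz) hz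
  have hax : φ a *ᵥ x ∈ L := by
    rw [haφ]
    refine L.sum_mem fun s _ => hsubT _ _ ?_
    rw [hsub]
    exact hx s
  have hrL : ∀ z ∈ L, φ (Polynomial.aeval a r) *ᵥ z ∈ L := by
    clear hr
    induction r using Polynomial.induction_on' with
    | add p q hp hq =>
      intro z hz
      rw [map_add, map_add, add_mulVec]
      exact L.add_mem (hp z hz) (hq z hz)
    | monomial m c =>
      intro z hz
      have hpow : ∀ m : ℕ, φ a ^ m *ᵥ z ∈ L := by
        intro m
        induction m with
        | zero => rwa [pow_zero, one_mulVec]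
        | succ m ih => rw [pow_succ', ← mulVec_mulVec]; exact haL _ ih
      have hc : φ (Polynomial.aeval a (Polynomial.monomial m c))
          = algebraMap ℚ K c • φ a ^ m := by
        rw [Polynomial.aeval_monomial, ← Algebra.smul_def, ← map_pow]
        ext i j
        simp [φ]
      rw [hc, smul_mulVec]
      exact L.smul_mem _ (hpow m)
  refine ⟨φ (1 + Polynomial.aeval a r * a) *ᵥ x, ?_, hT _ fun s hs => ?_⟩
  · rw [map_add, map_one, map_mul, add_mulVec, one_mulVec, add_sub_cancel_left, ← mulVec_mulVec]
    exact hrL _ hax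
  · rw [← sub_eq_zero, ← hsub, mulVec_mulVec, ← map_mul]
    have : (M s - 1) * (1 + Polynomial.aeval a r * a) = 0 := by
      ext i j
      exact congrFun (congrFun hr (⟨s, hs⟩, i)) j
    rw [this, map_zero, zero_mulVec]

end Reynolds

section TensorMatrices

open Matrix Kronecker

variable {R : Type*} [CommRing R]

/-- The matrix of the `s`-th tensor power of a matrix. -/
def tensorPowMatrix {J : Type*} (A : Matrix J J R) (s : ℕ) :
    Matrix (Fin s → J) (Fin s → J) R :=
  Matrix.of fun x y => ∏ j, A (x j) (y j)

theorem tensorPowMatrix_mul {J : Type*} [Fintype J] (A B : Matrix J J R) (s : ℕ) :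
    tensorPowMatrix A s * tensorPowMatrix B s = tensorPowMatrix (A * B) s := by
  ext x y
  simp only [tensorPowMatrix, mul_apply, of_apply, Finset.prod_univ_sum, Fintype.piFinset_univ,
    Finset.prod_mul_distrib]

theorem tensorPowMatrix_one {J : Type*} [DecidableEq J] (s : ℕ) :
    tensorPowMatrix (1 : Matrix J J R) s = 1 := by
  ext x y
  simp only [tensorPowMatrix, of_apply, one_apply, Finset.prod_ite_zero, Finset.prod_const_one,
    Finset.mem_univ, true_imp_iff, funext_iff]

theorem tensorPowMatrix_smul {J : Type*} (c : R) (A : Matrix J J R) (s : ℕ) :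
    tensorPowMatrix (c • A) s = c ^ s • tensorPowMatrix A s := by
  ext x y
  simp [tensorPowMatrix, Finset.prod_mul_distrib]

variable {n : ℕ}

/-- The matrix of the action on `T^p_q` of the matrix `A` with inverse `B`. -/
def tensorMatrix (p q : ℕ) (A B : Matrix (Fin n) (Fin n) R) :
    Matrix (TIdx n p q) (TIdx n p q) R :=
  tensorPowMatrix A p ⊗ₖ tensorPowMatrix Bᵀ q

theorem tensorMatrix_mul (p q : ℕ) (A B A' B' : Matrix (Fin n) (Fin n) R) :
    tensorMatrix p q A B * tensorMatrix p q A' B' = tensorMatrix p q (A * A') (B' * B) := by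
  rw [tensorMatrix, tensorMatrix, ← mul_kronecker_mul, tensorPowMatrix_mul, tensorPowMatrix_mul,
    ← transpose_mul, tensorMatrix]

theorem tensorMatrix_one (p q : ℕ) :
    tensorMatrix p q (1 : Matrix (Fin n) (Fin n) R) 1 = 1 := by
  rw [tensorMatrix, transpose_one, tensorPowMatrix_one, tensorPowMatrix_one, one_kronecker_one]

theorem tensorMatrix_mul_eq_one (p q : ℕ) {A B : Matrix (Fin n) (Fin n) R} (h : A * B = 1) :
    tensorMatrix p q A B * tensorMatrix p q B A = 1 := by
  rw [tensorMatrix_mul, h, tensorMatrix_one]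

theorem tensorMatrix_smul_right (c : R) (p q : ℕ) (A B : Matrix (Fin n) (Fin n) R) :
    tensorMatrix p q A (c • B) = c ^ q • tensorMatrix p q A B := by
  rw [tensorMatrix, transpose_smul, tensorPowMatrix_smul, kronecker_smul, tensorMatrix]

theorem tensorMatrix_smul_left (c : R) (p q : ℕ) (A B : Matrix (Fin n) (Fin n) R) :
    tensorMatrix p q (c • A) B = c ^ p • tensorMatrix p q A B := by
  rw [tensorMatrix, tensorPowMatrix_smul, smul_kronecker, tensorMatrix]

/-- The matrix of the action of `A` (with inverse `B`) on `T^a_b ⊗ (T^p_q)^{⊗s}`. -/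
def tensorTensorMatrix (a b p q s : ℕ) (A B : Matrix (Fin n) (Fin n) R) :
    Matrix (TIdx n a b × (Fin s → TIdx n p q)) (TIdx n a b × (Fin s → TIdx n p q)) R :=
  tensorMatrix a b A B ⊗ₖ tensorPowMatrix (tensorMatrix p q A B) s

theorem tensorTensorMatrix_mul_eq_one (a b p q s : ℕ) {A B : Matrix (Fin n) (Fin n) R}
    (h : A * B = 1) :
    tensorTensorMatrix a b p q s A B * tensorTensorMatrix a b p q s B A = 1 := by
  rw [tensorTensorMatrix, tensorTensorMatrix, ← mul_kronecker_mul, tensorPowMatrix_mul,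
    tensorMatrix_mul_eq_one _ _ h, tensorMatrix_mul_eq_one _ _ h, tensorPowMatrix_one,
    one_kronecker_one]

/-- The matrix of the action of `A` (with inverse `B`) on the matrix coefficients of linear maps
`T^a_b ⊗ (T^p_q)^{⊗s} → T^{a'}_{b'}`. -/
def homMatrix (a' b' a b p q s : ℕ) (A B : Matrix (Fin n) (Fin n) R) :
    Matrix (TIdx n a' b' × (TIdx n a b × (Fin s → TIdx n p q)))
      (TIdx n a' b' × (TIdx n a b × (Fin s → TIdx n p q))) R :=
  tensorMatrix a' b' A B ⊗ₖ (tensorTensorMatrix a b p q s B A)ᵀ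

theorem homMatrix_map {R' : Type*} [CommRing R'] (f : R →+* R') (a' b' a b p q s : ℕ)
    (A B : Matrix (Fin n) (Fin n) R) :
    (homMatrix a' b' a b p q s A B).map f
      = homMatrix a' b' a b p q s (A.map f) (B.map f) := by
  ext x y
  simp [homMatrix, tensorTensorMatrix, tensorMatrix, tensorPowMatrix]

theorem homMatrix_smul_right (c : R) (a' b' a b p q s : ℕ) (A B : Matrix (Fin n) (Fin n) R) :
    homMatrix a' b' a b p q s A (c • B)
      = c ^ (b' + a + p * s) • homMatrix a' b' a b p q s A B := by
  rw [homMatrix, tensorTensorMatrix, tensorMatrix_smul_right, tensorMatrix_smul_left,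
    tensorMatrix_smul_left, tensorPowMatrix_smul, smul_kronecker, smul_kronecker, kronecker_smul,
    transpose_smul, transpose_smul, kronecker_smul, kronecker_smul, smul_smul, smul_smul,
    homMatrix, tensorTensorMatrix, ← pow_mul, ← pow_add, ← pow_add]

/-- The action on coefficient matrices is conjugation of the corresponding linear maps. -/
theorem homMatrix_mulVec_apply (a' b' a b p q s : ℕ) (A B : Matrix (Fin n) (Fin n) R)
    (y : TIdx n a' b' × (TIdx n a b × (Fin s → TIdx n p q)) → R)
    (u : TIdx n a b × (Fin s → TIdx n p q) → R) :
    (Matrix.of fun κ x => (homMatrix a' b' a b p q s A B *ᵥ y) (κ, x)) *ᵥ u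
      = tensorMatrix a' b' A B *ᵥ ((Matrix.of fun κ x => y (κ, x)) *ᵥ
          (tensorTensorMatrix a b p q s B A *ᵥ u)) := by
  have h : (Matrix.of fun κ x => (homMatrix a' b' a b p q s A B *ᵥ y) (κ, x))
      = tensorMatrix a' b' A B * (Matrix.of fun κ x => y (κ, x)) *
          tensorTensorMatrix a b p q s B A := by
    ext κ x
    simp only [homMatrix, of_apply, mulVec, dotProduct, mul_apply,
      Fintype.sum_prod_type (α₁ := TIdx n a' b'), kroneckerMap_apply, transpose_apply,
      Finset.sum_mul]
    rw [Finset.sum_comm]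
    exact Finset.sum_congr rfl fun _ _ => Finset.sum_congr rfl fun _ _ => by ring
  rw [h, mulVec_mulVec, mulVec_mulVec]

/-- A vector fixed by all invertible rational matrices is fixed by all invertible matrices. -/
theorem homMatrix_mulVec_eq_of_rational {K : Type*} [Field K] [CharZero K]
    (a' b' a b p q s : ℕ)
    (y : TIdx n a' b' × (TIdx n a b × (Fin s → TIdx n p q)) → K)
    (hy : ∀ A B : Matrix (Fin n) (Fin n) ℚ, A * B = 1 →
      (homMatrix a' b' a b p q s A B).map (algebraMap ℚ K) *ᵥ y = y)
    (A B : Matrix (Fin n) (Fin n) K) (hAB : A * B = 1) :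
    homMatrix a' b' a b p q s A B *ᵥ y = y := by
  set N := b' + a + p * s with hN
  have hscale : ∀ A B : Matrix (Fin n) (Fin n) K, A * B = 1 →
      A.det ^ N • (homMatrix a' b' a b p q s A B *ᵥ y)
        = homMatrix a' b' a b p q s A A.adjugate *ᵥ y := by
    intro A B h
    have hB : A.adjugate = A.det • B := by
      calc A.adjugate = A.adjugate * (A * B) := by rw [h, Matrix.mul_one]
        _ = A.det • B := by rw [← Matrix.mul_assoc, adjugate_mul, smul_mul, Matrix.one_mul]
    rw [hB, homMatrix_smul_right, smul_mulVec]
  have hdet : ∀ A B : Matrix (Fin n) (Fin n) K, A * B = 1 → A.det ≠ 0 := by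
    intro A B h h0
    have := congrArg Matrix.det h
    rw [det_mul, h0, zero_mul, det_one] at this
    exact zero_ne_one this
  let X := Matrix.mvPolynomialX (Fin n) (Fin n) K
  let Y := fun z => MvPolynomial.C (σ := Fin n × Fin n) (y z)
  have hev : ∀ (A : Matrix (Fin n) (Fin n) K) z,
      eval (fun x : Fin n × Fin n => A x.1 x.2)
        (X.det * ((homMatrix a' b' a b p q s X X.adjugate *ᵥ Y) z - X.det ^ N * Y z))
      = A.det * ((homMatrix a' b' a b p q s A A.adjugate *ᵥ y) z - A.det ^ N * y z) := by
    intro A z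
    have hX : X.map (eval fun x : Fin n × Fin n => A x.1 x.2) = A :=
      mvPolynomialX_mapMatrix_eval A
    have hXa : X.adjugate.map (eval fun x : Fin n × Fin n => A x.1 x.2) = A.adjugate := by
      rw [← RingHom.mapMatrix_apply, RingHom.map_adjugate, RingHom.mapMatrix_apply, hX]
    have hXd : eval (fun x : Fin n × Fin n => A x.1 x.2) X.det = A.det := by
      rw [RingHom.map_det, RingHom.mapMatrix_apply, hX]
    have hYz : ∀ z, eval (fun x : Fin n × Fin n => A x.1 x.2) (Y z) = y z := fun z => eval_C _
    rw [map_mul, map_sub, map_mul, map_pow, hXd, hYz, RingHom.map_mulVec, homMatrix_map, hX, hXa]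
    congr
    ext z
    exact hYz z
  have hzero : ∀ z, X.det * ((homMatrix a' b' a b p q s X X.adjugate *ᵥ Y) z - X.det ^ N * Y z)
      = 0 := by
    intro z
    refine MvPolynomial.funext_set (fun _ => Set.range (algebraMap ℚ K))
      (fun _ => Set.infinite_range_of_injective (algebraMap ℚ K).injective) fun x hx => ?_
    choose x₀ hx₀ using fun i => hx i (Set.mem_univ i)
    let A₀ : Matrix (Fin n) (Fin n) ℚ := Matrix.of fun i j => x₀ (i, j)
    have hxA : x = fun i : Fin n × Fin n => (A₀.map (algebraMap ℚ K)) i.1 i.2 :=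
      funext fun i => (hx₀ i).symm
    rw [hxA, hev, map_zero]
    rcases eq_or_ne A₀.det 0 with h0 | h0
    · have : (A₀.map (algebraMap ℚ K)).det = 0 := by
        rw [← RingHom.mapMatrix_apply, ← RingHom.map_det, h0, map_zero]
      rw [this, zero_mul]
    · have hinv : A₀ * A₀⁻¹ = 1 := mul_nonsing_inv _ (isUnit_iff_ne_zero.2 h0)
      have hinvK : A₀.map (algebraMap ℚ K) * A₀⁻¹.map (algebraMap ℚ K) = 1 := by
        have := congrArg (algebraMap ℚ K).mapMatrix hinv
        rwa [map_mul, map_one] at this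
      have h1 := hy _ _ hinv
      rw [homMatrix_map] at h1
      rw [← hscale _ _ hinvK, h1, Pi.smul_apply, smul_eq_mul, sub_self, mul_zero]
  have hd := hdet A B hAB
  funext z
  have h := hev A z
  rw [hzero, map_zero, ← hscale A B hAB, Pi.smul_apply, smul_eq_mul, ← mul_sub] at h
  have h' := (mul_eq_zero.1 ((mul_eq_zero.1 h.symm).resolve_left hd)).resolve_left
    (pow_ne_zero _ hd)
  exact sub_eq_zero.1 h'

end TensorMatrices

section LinearJets

open Matrix

variable {K : Type} [Field K] {n p q : ℕ}

theorem kAct_eq_mulVec (A B : Matrix (Fin n) (Fin n) K) (w : TConst K n p q) :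
    kAct A B w = tensorMatrix p q A B *ᵥ w :=
  rfl

theorem cAct_eq_mulVec {a b s : ℕ} (A B : Matrix (Fin n) (Fin n) K)
    (u : TIdx n a b × (Fin s → TIdx n p q) → K) :
    cAct A B u = tensorTensorMatrix a b p q s A B *ᵥ u := by
  funext x
  rw [mulVec, dotProduct, Fintype.sum_prod_type]
  rfl

theorem cAct_elemT {a b : ℕ} (A B : Matrix (Fin n) (Fin n) K) (w : TConst K n a b)
    (v : TConst K n p q) (s : ℕ) :
    cAct A B (elemT w v s) = elemT (kAct A B w) (kAct A B v) s := by
  funext x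
  simp only [cAct, elemT, kAct, Finset.prod_univ_sum, Fintype.piFinset_univ, Finset.sum_mul_sum,
    Finset.prod_mul_distrib]
  exact Finset.sum_congr rfl fun _ _ => Finset.sum_congr rfl fun _ _ => by ring

/-- The linear jet with matrix `A`. -/
noncomputable def linearJet (A : Matrix (Fin n) (Fin n) K) (i : Fin n) :
    MvPolynomial (Fin n) K :=
  ∑ j, C (A i j) * X j

theorem constantCoeff_linearJet (A : Matrix (Fin n) (Fin n) K) (i : Fin n) :
    constantCoeff (linearJet A i) = 0 := by
  simp [linearJet]

theorem pderiv_linearJet (A : Matrix (Fin n) (Fin n) K) (i j : Fin n) :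
    pderiv j (linearJet A i) = C (A i j) := by
  simp [linearJet, pderiv_X, Pi.single_apply]

theorem bind₁_linearJet (A B : Matrix (Fin n) (Fin n) K) (h : A * B = 1) (i : Fin n) :
    bind₁ (linearJet B) (linearJet A i) = X i := by
  have h1 : bind₁ (linearJet B) (linearJet A i) = ∑ l, C ((A * B) i l) * X l := by
    simp only [linearJet, map_sum, map_mul, bind₁_C_right, bind₁_X_right, mul_apply,
      Finset.mul_sum, Finset.sum_mul]
    rw [Finset.sum_comm]
    exact Finset.sum_congr rfl fun _ _ => Finset.sum_congr rfl fun _ _ => by ring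
  rw [h1, h]
  simp [one_apply]

theorem truncP_X (k : ℕ) (i : Fin n) :
    truncP (k + 1) (X i : MvPolynomial (Fin n) K) = X i := by
  have h : ∀ d, homogeneousComponent d (X i : MvPolynomial (Fin n) K)
      = if d = 1 then X i else 0 := fun d => by
    rw [homogeneousComponent_of_mem (isHomogeneous_X K i)]
  simp [truncP, h]

theorem constantCoeff_truncP (k : ℕ) (f : MvPolynomial (Fin n) K) :
    constantCoeff (truncP k f) = constantCoeff f := by
  rw [truncP, map_sum, Finset.sum_eq_single_of_mem 0 (by simp)]
  · simp [homogeneousComponent_zero, constantCoeff_eq]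
  · intro d _ hd
    rw [constantCoeff_eq, coeff_homogeneousComponent, if_neg]
    simpa using hd.symm

theorem totalDegree_truncP_le (k : ℕ) (f : MvPolynomial (Fin n) K) :
    (truncP k f).totalDegree ≤ k :=
  totalDegree_finsetSum_le fun d hd =>
    (homogeneousComponent_isHomogeneous d f).totalDegree_le.trans
      (Nat.lt_succ_iff.1 (Finset.mem_range.1 hd))

theorem jetPair_linearJet (k : ℕ) {A B : Matrix (Fin n) (Fin n) K} (hAB : A * B = 1)
    (hBA : B * A = 1) : JetPair K n k (linearJet A) (linearJet B) :=
  ⟨constantCoeff_linearJet A, constantCoeff_linearJet B,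
    fun i => by rw [bind₁_linearJet A B hAB, truncP_X],
    fun i => by rw [bind₁_linearJet B A hBA, truncP_X]⟩

theorem Dmat0_linearJet (A : Matrix (Fin n) (Fin n) K) : Dmat0 K n (linearJet A) = A := by
  ext i j
  simp [Dmat0, pderiv_linearJet]

theorem constantCoeff_push_linearJet (k : ℕ) (A B : Matrix (Fin n) (Fin n) K)
    (v : TField K n p q) :
    (fun idx => constantCoeff (push K n k p q (linearJet A) (linearJet B) v idx))
      = kAct A B fun idx => constantCoeff (v idx) := by
  have hc : ∀ f, constantCoeff (bind₁ (linearJet B) f) = constantCoeff f := by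
    intro f
    induction f using MvPolynomial.induction_on with
    | C a => simp
    | add f g hf hg => simp [hf, hg]
    | mul_X f i hf => simp [constantCoeff_linearJet]
  funext idx
  simp only [push, constantCoeff_truncP, map_sum, map_mul, map_prod, hc, pderiv_linearJet,
    constantCoeff_C]
  rfl

theorem IsJetEquivariant.push_linearJet {k p' q' : ℕ} {δ : TField K n p q → TConst K n p' q'}
    (hδ : IsJetEquivariant K n k p q p' q' δ) {A B : Matrix (Fin n) (Fin n) K}
    (hAB : A * B = 1) (hBA : B * A = 1) (v : TField K n p q)
    (hv : ∀ idx, (v idx).totalDegree ≤ k) :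
    δ (push K n k p q (linearJet A) (linearJet B) v) = kAct A B (δ v) := by
  rw [hδ _ _ (jetPair_linearJet k hAB hBA) v hv, Dmat0_linearJet, Dmat0_linearJet]

end LinearJets

section Noetherian

variable {K : Type} [Field K]

/-- The inclusion of polynomials in the order-zero component into polynomials on `J^k V`. -/
noncomputable def orderZero (K : Type) [Field K] (n p q k : ℕ) :
    MvPolynomial (TIdx n p q) K →+* MvPolynomial (CIdx n p q k) K :=
  (rename fun idx => (idx, ⟨0, by simp⟩) : MvPolynomial (TIdx n p q) K →ₐ[K] _).toRingHom

theorem eval_orderZero {n p q k : ℕ} (v : TField K n p q) (c : MvPolynomial (TIdx n p q) K) :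
    eval (fun s : CIdx n p q k => (v s.1).coeff s.2.1) (orderZero K n p q k c)
      = eval (fun idx => constantCoeff (v idx)) c := by
  simp only [orderZero, AlgHom.toRingHom_eq_coe, RingHom.coe_coe, eval_rename]
  rfl

instance finite_CIdx (n p q k : ℕ) : Finite (CIdx n p q k) := by
  have : Finite {m : Fin n →₀ ℕ // (m.sum fun _ e => e) ≤ k} :=
    Finsupp.finite_of_degree_le k
  infer_instance

/-- A polynomial of degree `≤ d` in the positive-order components is a combination, over the
polynomials in the order-zero component, of monomials of degree `≤ d`. -/
theorem exists_sum_orderZero_mul {n p q k d : ℕ} (m : CIdx n p q k →₀ ℕ)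
    (hm : (∑ s ∈ m.support.filter (fun s : CIdx n p q k => s.2.1 ≠ 0), m s) ≤ d) (r : K) :
    ∃ (c : MvPolynomial (TIdx n p q) K) (m' : CIdx n p q k →₀ ℕ), m'.degree ≤ d ∧
      monomial m r = orderZero K n p q k c * monomial m' 1 := by
  classical
  let e : TIdx n p q → CIdx n p q k := fun idx => (idx, ⟨0, by simp⟩)
  have he : Function.Injective e := fun x y h => congrArg Prod.fst h
  refine ⟨monomial (m.comapDomain e he.injOn) r, m.filter fun s => s.2.1 ≠ 0, ?_, ?_⟩
  · rw [Finsupp.degree_apply, Finsupp.support_filter]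
    refine le_trans (le_of_eq (Finset.sum_congr rfl fun s hs => ?_)) hm
    exact Finsupp.filter_apply_pos _ _ (Finset.mem_filter.1 hs).2
  · have h0 : (m.comapDomain e he.injOn).mapDomain e = m.filter fun s => s.2.1 = 0 := by
      ext s
      by_cases hs : s.2.1 = 0
      · have : s = e s.1 := Prod.ext rfl (Subtype.ext hs)
        rw [Finsupp.filter_apply_pos (fun s : CIdx n p q k => s.2.1 = 0) m hs, this,
          Finsupp.mapDomain_apply he, Finsupp.comapDomain_apply]
      · rw [Finsupp.filter_apply_neg (fun s : CIdx n p q k => s.2.1 = 0) m hs,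
          Finsupp.mapDomain_of_notMem_range]
        rintro ⟨x, rfl⟩
        exact hs rfl
    have h1 : orderZero K n p q k (monomial (m.comapDomain e he.injOn) r)
        = monomial (m.filter fun s => s.2.1 = 0) r := by
      rw [← h0]
      exact rename_monomial e _ r
    rw [h1, monomial_mul, mul_one, Finsupp.filter_add_filter_not]

/-- Any set of polynomials of bounded degree in the positive-order components is generated, over
the polynomials in the order-zero component, by finitely many of its elements. -/
theorem exists_finite_generators {n p q k d : ℕ} (Z : Set (MvPolynomial (CIdx n p q k) K))
    (hZ : ∀ f ∈ Z, ∀ m ∈ f.support,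
      (∑ s ∈ m.support.filter (fun s : CIdx n p q k => s.2.1 ≠ 0), m s) ≤ d) :
    ∃ (M : ℕ) (z : Fin M → MvPolynomial (CIdx n p q k) K), (∀ i, z i ∈ Z) ∧
      ∀ f ∈ Z, ∃ c : Fin M → MvPolynomial (TIdx n p q) K,
        f = ∑ i, orderZero K n p q k (c i) * z i := by
  let _ : Module (MvPolynomial (TIdx n p q) K) (MvPolynomial (CIdx n p q k) K) :=
    Module.compHom _ (orderZero K n p q k)
  have hsmul : ∀ (c : MvPolynomial (TIdx n p q) K) (f : MvPolynomial (CIdx n p q k) K),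
      c • f = orderZero K n p q k c * f := fun _ _ => rfl
  let N : Submodule (MvPolynomial (TIdx n p q) K) (MvPolynomial (CIdx n p q k) K) :=
    Submodule.span _ ((fun m => monomial m (1 : K)) '' {m | m.degree ≤ d})
  have hN : N.FG := Submodule.fg_span ((Finsupp.finite_of_degree_le d).image _)
  have hZN : Submodule.span (MvPolynomial (TIdx n p q) K) Z ≤ N := by
    refine Submodule.span_le.2 fun f hf => ?_
    rw [← f.support_sum_monomial_coeff]
    refine N.sum_mem fun m hm => ?_
    obtain ⟨c, m', hm', h⟩ := exists_sum_orderZero_mul m (hZ f hf m hm) (f.coeff m)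
    rw [h, ← hsmul]
    exact N.smul_mem _ (Submodule.subset_span ⟨m', hm', rfl⟩)
  have hfg : (Submodule.span (MvPolynomial (TIdx n p q) K) Z).FG :=
    Submodule.FG.of_le hN hZN
  obtain ⟨T, hTZ, hT⟩ := (Submodule.fg_span_iff_fg_span_finset_subset Z).1 hfg
  refine ⟨T.card, fun i => (T.equivFin.symm i : _), fun i => hTZ (T.equivFin.symm i).2,
    fun f hf => ?_⟩
  have hrange : Set.range (fun i => (T.equivFin.symm i : MvPolynomial (CIdx n p q k) K)) = T := by
    ext x
    constructor
    · rintro ⟨i, rfl⟩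
      exact (T.equivFin.symm i).2
    · intro hx
      exact ⟨T.equivFin ⟨x, hx⟩, by simp⟩
  have hmem : f ∈ Submodule.span (MvPolynomial (TIdx n p q) K) Z := Submodule.subset_span hf
  rw [hT, ← hrange, Submodule.mem_span_range_iff_exists_fun] at hmem
  obtain ⟨c, hc⟩ := hmem
  exact ⟨c, hc.symm⟩

/-- A polynomial function is a combination of products of coordinates. -/
theorem exists_finsupp_eval_eq {τ : Type*} (c : MvPolynomial τ K) :
    ∃ b : (Σ s : ℕ, Fin s → τ) →₀ K, ∀ v : τ → K,
      eval v c = b.sum fun x r => r * ∏ j, v (x.2 j) := by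
  induction c using MvPolynomial.induction_on' with
  | monomial m r =>
    let l := m.toMultiset.toList
    refine ⟨Finsupp.single ⟨l.length, l.get⟩ r, fun v => ?_⟩
    rw [Finsupp.sum_single_index (zero_mul _), eval_monomial, ← List.prod_ofFn]
    have h : List.ofFn (fun j => v (l.get j)) = l.map v := by
      have := List.map_ofFn (f := l.get) (g := v)
      rwa [List.ofFn_get, eq_comm] at this
    rw [h, ← Multiset.prod_coe, ← Multiset.map_coe, Multiset.coe_toList,
      Finsupp.toMultiset_map, Finsupp.prod_toMultiset, Finsupp.prod_mapDomain_index]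
    · simp
    · intro _ _ _
      exact pow_add _ _ _
  | add f g hf hg =>
    obtain ⟨b, hb⟩ := hf
    obtain ⟨b', hb'⟩ := hg
    refine ⟨b + b', fun v => ?_⟩
    rw [map_add, hb, hb', Finsupp.sum_add_index']
    · intro _
      exact zero_mul _
    · intro _ _ _
      exact add_mul _ _ _

/-- Finitely many polynomial functions are combinations of products of boundedly many
coordinates. -/
theorem exists_bound_eval_eq {τ ι : Type*} [Fintype τ] [Fintype ι] (c : ι → MvPolynomial τ K) :
    ∃ (S : ℕ) (b : ι → ∀ s : Fin S, (Fin (s : ℕ) → τ) → K), ∀ i (v : τ → K),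
      eval v (c i) = ∑ s : Fin S, ∑ f : Fin (s : ℕ) → τ, b i s f * ∏ j, v (f j) := by
  classical
  choose b hb using fun i => exists_finsupp_eval_eq (c i)
  let U : Finset ℕ := Finset.univ.biUnion fun i => (b i).support.image Sigma.fst
  refine ⟨U.sup id + 1, fun i s f => b i ⟨s, f⟩, fun i v => ?_⟩
  rw [hb, Finsupp.sum, Fin.sum_univ_eq_sum_range
    (fun s => ∑ f : Fin s → τ, b i ⟨s, f⟩ * ∏ j, v (f j)), Finset.sum_sigma']
  refine Finset.sum_subset (fun x hx => ?_) fun x _ hx => ?_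
  · rw [Finset.mem_sigma, Finset.mem_range, Nat.lt_succ_iff]
    refine ⟨Finset.le_sup (f := id) ?_, Finset.mem_univ _⟩
    exact Finset.mem_biUnion.2 ⟨i, Finset.mem_univ i, Finset.mem_image_of_mem _ hx⟩
  · rw [Finsupp.notMem_support_iff.1 hx, zero_mul]

end Noetherian

section Averaging

open Matrix

theorem blockDiagonal'_mulVec_apply {R : Type*} [CommRing R] {β : Type*} [Fintype β]
    [DecidableEq β] {J : β → Type*} [∀ c, Fintype (J c)] (M : ∀ c, Matrix (J c) (J c) R)
    (y : (Σ c, J c) → R) (c : β) (j : J c) :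
    (blockDiagonal' M *ᵥ y) ⟨c, j⟩ = (M c *ᵥ fun j => y ⟨c, j⟩) j := by
  simp only [mulVec, dotProduct, Fintype.sum_sigma]
  rw [Fintype.sum_eq_single c]
  · simp only [blockDiagonal'_apply_eq]
  · intro c' hc'
    exact Finset.sum_eq_zero fun j' _ => by
      rw [blockDiagonal'_apply_ne _ _ _ hc'.symm, zero_mul]

/-- If equivariant data `w` is a sum of images of equivariant data `u c` under linear maps, then
these linear maps can be chosen equivariant. -/
theorem exists_fixed_coefficients {K : Type} [Field K] [CharZero K] {n p q p' q' : ℕ}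
    {β V : Type*} [Fintype β] (a b s : β → ℕ)
    (u : V → ∀ c, TIdx n (a c) (b c) × (Fin (s c) → TIdx n p q) → K)
    (w : V → TConst K n p' q')
    (hV : ∀ A B : Matrix (Fin n) (Fin n) K, A * B = 1 → B * A = 1 → ∀ v, ∃ v',
      (∀ c, u v' c = cAct A B (u v c)) ∧ w v' = kAct A B (w v))
    (Ψ : ∀ c, TIdx n p' q' × (TIdx n (a c) (b c) × (Fin (s c) → TIdx n p q)) → K)
    (hΨ : ∀ v, w v = ∑ c, (Matrix.of fun κ x => Ψ c (κ, x)) *ᵥ u v c) :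
    ∃ Φ : ∀ c, TIdx n p' q' × (TIdx n (a c) (b c) × (Fin (s c) → TIdx n p q)) → K,
      (∀ v, w v = ∑ c, (Matrix.of fun κ x => Φ c (κ, x)) *ᵥ u v c) ∧
      ∀ (c : β) (A B : Matrix (Fin n) (Fin n) K), A * B = 1 →
        homMatrix p' q' (a c) (b c) p q (s c) A B *ᵥ Φ c = Φ c := by
  classical
  let J : β → Type := fun c =>
    TIdx n p' q' × (TIdx n (a c) (b c) × (Fin (s c) → TIdx n p q))
  let S := {P : Matrix (Fin n) (Fin n) ℚ × Matrix (Fin n) (Fin n) ℚ // P.1 * P.2 = 1}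
  let M : S → Matrix (Σ c, J c) (Σ c, J c) ℚ := fun P =>
    blockDiagonal' fun c => homMatrix p' q' (a c) (b c) p q (s c) P.1.1 P.1.2
  let ev : ((Σ c, J c) → K) →ₗ[K] V → TConst K n p' q' :=
    { toFun := fun y v => ∑ c, (Matrix.of fun κ x => y ⟨c, (κ, x)⟩) *ᵥ u v c
      map_add' := fun y z => by
        funext v
        rw [Pi.add_apply, ← Finset.sum_add_distrib]
        exact Finset.sum_congr rfl fun c _ => by rw [← add_mulVec]; rfl
      map_smul' := fun r y => by
        funext v
        rw [Pi.smul_apply, Finset.smul_sum]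
        exact Finset.sum_congr rfl fun c _ => by rw [← smul_mulVec]; rfl }
  have hMK : ∀ P : S, ∀ y c, (fun j => ((M P).map (algebraMap ℚ K) *ᵥ y) ⟨c, j⟩)
      = homMatrix p' q' (a c) (b c) p q (s c) (P.1.1.map (algebraMap ℚ K))
          (P.1.2.map (algebraMap ℚ K)) *ᵥ fun j => y ⟨c, j⟩ := by
    intro P y c
    funext j
    rw [blockDiagonal'_map _ _ (map_zero _), blockDiagonal'_mulVec_apply, homMatrix_map]
  have hK : ∀ A B : Matrix (Fin n) (Fin n) ℚ, A * B = 1 →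
      A.map (algebraMap ℚ K) * B.map (algebraMap ℚ K) = 1 := by
    intro A B h
    have := congrArg (algebraMap ℚ K).mapMatrix h
    rwa [map_mul, map_one] at this
  have hev : ∀ (P : S) (v : V), ∃ v', (∀ y, ev ((M P).map (algebraMap ℚ K) *ᵥ y) v
      = kAct (P.1.1.map (algebraMap ℚ K)) (P.1.2.map (algebraMap ℚ K)) (ev y v')) ∧
      kAct (P.1.1.map (algebraMap ℚ K)) (P.1.2.map (algebraMap ℚ K)) (w v') = w v := by
    intro P v
    have h := hK _ _ P.2
    have h' := mul_eq_one_comm.1 h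
    obtain ⟨v', hu, hw⟩ := hV _ _ h' h v
    refine ⟨v', fun y => ?_, ?_⟩
    · change ∑ c, _ = kAct _ _ (∑ c, _)
      rw [kAct_eq_mulVec, mulVec_sum]
      refine Finset.sum_congr rfl fun c _ => ?_
      rw [hu, cAct_eq_mulVec]
      have hc := homMatrix_mulVec_apply p' q' (a c) (b c) p q (s c)
        (P.1.1.map (algebraMap ℚ K)) (P.1.2.map (algebraMap ℚ K)) (fun j => y ⟨c, j⟩) (u v c)
      rwa [← hMK] at hc
    · rw [hw, kAct_eq_mulVec, kAct_eq_mulVec, mulVec_mulVec, tensorMatrix_mul_eq_one _ _ h,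
        one_mulVec]
  have hL : ∀ P, ∀ y ∈ LinearMap.ker ev, (M P).map (algebraMap ℚ K) *ᵥ y ∈ LinearMap.ker ev := by
    intro P y hy
    rw [LinearMap.mem_ker] at hy ⊢
    funext v
    obtain ⟨v', hv', -⟩ := hev P v
    rw [hv', hy, Pi.zero_apply, kAct_eq_mulVec, mulVec_zero]
    rfl
  let x : (Σ c, J c) → K := fun z => Ψ z.1 z.2
  have hx : ev x = w := funext fun v => (hΨ v).symm
  obtain ⟨y, hyx, hy⟩ := exists_fixed_of_transpose_stable M (LinearMap.ker ev) hL
    (fun P => by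
      have hP : P.1.1ᵀ * P.1.2ᵀ = 1 := by
        rw [← transpose_mul, mul_eq_one_comm.1 P.2, transpose_one]
      have hT : (M P)ᵀ = M ⟨(P.1.1ᵀ, P.1.2ᵀ), hP⟩ := blockDiagonal'_transpose _
      rw [hT]
      exact hL _)
    x (fun P => by
      rw [LinearMap.mem_ker, map_sub, sub_eq_zero]
      funext v
      obtain ⟨v', hv', hw⟩ := hev P v
      rw [hv', hx, hw])
  refine ⟨fun c j => y ⟨c, j⟩, fun v => ?_, fun c A B hAB => ?_⟩
  · rw [LinearMap.mem_ker, map_sub, sub_eq_zero, hx] at hyx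
    rw [← hyx]
    rfl
  · refine homMatrix_mulVec_eq_of_rational _ _ _ _ _ _ _ _ (fun A B h => ?_) A B hAB
    rw [homMatrix_map, ← hMK ⟨(A, B), h⟩ y c, hy]

/-- A fixed coefficient vector defines an equivariant linear map. -/
theorem mulVec_cAct_of_fixed {K : Type} [Field K] {n a' b' a b p q s : ℕ}
    (y : TIdx n a' b' × (TIdx n a b × (Fin s → TIdx n p q)) → K)
    {A B : Matrix (Fin n) (Fin n) K} (hBA : B * A = 1)
    (hy : homMatrix a' b' a b p q s A B *ᵥ y = y)
    (u : TIdx n a b × (Fin s → TIdx n p q) → K) :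
    (Matrix.of fun κ x => y (κ, x)) *ᵥ cAct A B u
      = kAct A B ((Matrix.of fun κ x => y (κ, x)) *ᵥ u) := by
  have h := homMatrix_mulVec_apply a' b' a b p q s A B y (cAct A B u)
  rw [hy, cAct_eq_mulVec, mulVec_mulVec (M := tensorTensorMatrix a b p q s B A),
    tensorTensorMatrix_mul_eq_one _ _ _ _ _ hBA, one_mulVec] at h
  rw [cAct_eq_mulVec, h, kAct_eq_mulVec]

end Averaging

/-- **Finiteness theorem.** For fixed `n, k, d` and `V = T^p_q`, there exist finitely many
tensor types `W_i = T^{p_i}_{q_i}` and `JGL^{k+1}(n)`-equivariant polynomial maps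
`δ_i : J^k V → W_i` of degree `≤ d` in the positive-order components, such that every
`JGL^{k+1}(n)`-equivariant polynomial map `δ : J^k V → W` of degree `≤ d` in the
positive-order components can be written as a finite sum
`δ(v) = Σ_{i,s} Φ_{i,s}(δ_i(v) ⊗ v_0^{⊗s})` with `GL(n,K)`-equivariant linear maps
`Φ_{i,s} : W_i ⊗ Sym^s V → W`, where `v_0` is the order-zero component of `v`. -/
theorem finiteness_of_natural_operations (K : Type) [Field K] [CharZero K]
    (n k d p q : ℕ) (hn : 1 ≤ n) (hk : 1 ≤ k) (hd : 1 ≤ d) :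
    ∃ (M : ℕ) (pi qi : Fin M → ℕ)
      (Fi : (i : Fin M) → TIdx n (pi i) (qi i) → MvPolynomial (CIdx n p q k) K),
      (∀ i, PosDegLE n p q k (pi i) (qi i) d (Fi i)) ∧
      (∀ i, IsJetEquivariant K n k p q (pi i) (qi i) (evalPoly (Fi i))) ∧
      (∀ (p' q' : ℕ) (F : TIdx n p' q' → MvPolynomial (CIdx n p q k) K),
        PosDegLE n p q k p' q' d F →
        IsJetEquivariant K n k p q p' q' (evalPoly F) →
        ∃ (S : ℕ)
          (Φ : (i : Fin M) → (s : Fin S) →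
            ((TIdx n (pi i) (qi i) × (Fin (s : ℕ) → TIdx n p q)) → K) →ₗ[K]
              TConst K n p' q'),
          (∀ (i : Fin M) (s : Fin S) (A Ai : Matrix (Fin n) (Fin n) K),
            A * Ai = 1 → Ai * A = 1 →
            ∀ u, Φ i s (cAct A Ai u) = kAct A Ai (Φ i s u)) ∧
          (∀ v : TField K n p q, (∀ idx, (v idx).totalDegree ≤ k) →
            evalPoly F v = ∑ i : Fin M, ∑ s : Fin S,
              Φ i s (elemT (evalPoly (Fi i) v)
                (fun idx => constantCoeff (v idx)) (s : ℕ)))) := by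
  let Z : Set (MvPolynomial (CIdx n p q k) K) :=
    {z | ∃ (a b : ℕ) (F : TIdx n a b → MvPolynomial (CIdx n p q k) K) (κ : TIdx n a b),
      PosDegLE n p q k a b d F ∧ IsJetEquivariant K n k p q a b (evalPoly F) ∧ F κ = z}
  obtain ⟨M, z, hzZ, hz⟩ := exists_finite_generators (d := d) Z (by
    rintro _ ⟨a, b, F, κ, hF, -, rfl⟩
    exact hF κ)
  choose a b Fi κ₀ hdeg hequiv hκ₀ using hzZ
  refine ⟨M, a, b, Fi, hdeg, hequiv, fun p' q' F hF hFe => ?_⟩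
  choose c hc using fun κ => hz (F κ) ⟨p', q', F, κ, hF, hFe, rfl⟩
  obtain ⟨S, e, he⟩ := exists_bound_eval_eq fun i : TIdx n p' q' × Fin M => c i.1 i.2
  obtain ⟨Φ, hΦ, hfix⟩ := exists_fixed_coefficients (K := K) (n := n) (p := p) (q := q)
    (V := {v : TField K n p q // ∀ idx, (v idx).totalDegree ≤ k})
    (fun x : Fin M × Fin S => a x.1) (fun x => b x.1) (fun x => x.2)
    (fun v x => elemT (evalPoly (Fi x.1) v.1) (fun idx => constantCoeff (v.1 idx)) x.2)
    (fun v => evalPoly F v.1)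
    (fun A B hAB hBA v => ⟨⟨push K n k p q (linearJet A) (linearJet B) v.1,
        fun idx => totalDegree_truncP_le k _⟩,
      fun x => by
        rw [(hequiv x.1).push_linearJet hAB hBA v.1 v.2, constantCoeff_push_linearJet,
          cAct_elemT],
      hFe.push_linearJet hAB hBA v.1 v.2⟩)
    (fun x y => if y.2.1 = κ₀ x.1 then e (y.1, x.1) x.2 y.2.2 else 0)
    (fun v => by
      funext κ
      rw [evalPoly, hc, map_sum, Finset.sum_apply, Fintype.sum_prod_type]
      refine Finset.sum_congr rfl fun i _ => ?_
      rw [map_mul, eval_orderZero, he (κ, i), Finset.sum_mul]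
      refine Finset.sum_congr rfl fun s _ => ?_
      simp only [Matrix.mulVec, dotProduct, Fintype.sum_prod_type (α₁ := TIdx n (a i) (b i)),
        Matrix.of_apply, elemT]
      rw [Fintype.sum_eq_single (κ₀ i) fun κ' hκ' => by simp [hκ'], Finset.sum_mul]
      refine Finset.sum_congr rfl fun f _ => ?_
      rw [if_pos rfl, evalPoly, hκ₀]
      ring)
  refine ⟨S, fun i s => Matrix.mulVecLin (Matrix.of fun κ x => Φ (i, s) (κ, x)),
    fun i s A B hAB hBA u => ?_, fun v hv => ?_⟩
  · exact mulVec_cAct_of_fixed _ hBA (hfix (i, s) A B hAB) u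
  · rw [hΦ ⟨v, hv⟩, Fintype.sum_prod_type]
    rfl
end

section
/- Let K be a field of characteristic zero, n ≥ 1, 0 ≤ m ≤ n, and k ≥ 0. Let Ω^m_{≤k} denote the space of polynomial differential m-forms on K^n with coefficients of degree ≤ k. For a polynomial map g : K^n → K^n with g(0) = 0 and Dg(0) invertible, let g·ω denote the pushforward of ω (defined by (g·ω)_x = ω_{g^{-1}(x)} ∘ (Dg(g^{-1}(x))^{-1})^{×m} with g^{-1} the formal inverse, truncated to coefficient degree ≤ k); the truncation depends only on the (k+1)-jet of g. Suppose δ : Ω^m_{≤k} → Λ^{m+1}(K^n)^* is a linear map which is natural, i.e. δ(g·ω) = δ(ω) ∘ (Dg(0)^{-1})^{×(m+1)} for all such g and all ω. Then there is a constant c ∈ K such that δ(ω) = c·(dω)(0) for every ω ∈ Ω^m_{≤k}. (Schouten's theorem for differential forms: the exterior differential is the only natural linear operation.) -/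
open MvPolynomial

/-- Antisymmetry of the components of a polynomial differential form. -/
def IsAltC {K : Type} [CommRing K] {n m : ℕ}
    (c : (Fin m → Fin n) → MvPolynomial (Fin n) K) : Prop :=
  ∀ (σ : Equiv.Perm (Fin m)) (i : Fin m → Fin n),
    c (i ∘ σ) = (Equiv.Perm.sign σ : ℤ) • c i

/-- Exterior differential on components. -/
noncomputable def extd {K : Type} [CommRing K] {n m : ℕ}
    (c : (Fin m → Fin n) → MvPolynomial (Fin n) K) :
    (Fin (m + 1) → Fin n) → MvPolynomial (Fin n) K :=
  fun i => ∑ t : Fin (m + 1), ((-1 : K) ^ (t : ℕ)) • pderiv (i t) (c (i ∘ t.succAbove))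

/-- Pushforward of a polynomial `m`-form under the jet `g` (with inverse jet `h`):
`(g·ω)_x = ω_{g⁻¹(x)} ∘ (Dg(g⁻¹(x))⁻¹)^{×m}`, truncated to coefficient degree `≤ k`.
In components `(g·ω)_I = Σ_{I'} (∏_t ∂_{I(t)} h_{I'(t)}) · (ω_{I'} ∘ h)`. -/
noncomputable def pushForm (K : Type) [Field K] (n k m : ℕ)
    (g h : Fin n → MvPolynomial (Fin n) K)
    (ω : (Fin m → Fin n) → MvPolynomial (Fin n) K) :
    (Fin m → Fin n) → MvPolynomial (Fin n) K :=
  fun I => truncP k (∑ I' : Fin m → Fin n,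
    (∏ t, pderiv (I t) (h (I' t))) * bind₁ h (ω I'))

section Truncation

variable {K : Type} [Field K] {N : ℕ}

theorem coeff_truncP (k : ℕ) (f : MvPolynomial (Fin N) K) (d : Fin N →₀ ℕ) :
    coeff d (truncP k f) = if d.degree ≤ k then coeff d f else 0 := by
  simp only [truncP, coeff_sum, coeff_homogeneousComponent]
  rw [Finset.sum_ite_eq]
  simp

theorem truncP_eq_self {k : ℕ} {f : MvPolynomial (Fin N) K} (hf : f.totalDegree ≤ k) :
    truncP k f = f := by
  ext d
  rw [coeff_truncP]
  split_ifs with h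
  · rfl
  · by_contra h0
    have := le_totalDegree (mem_support_iff.2 (Ne.symm h0))
    simp only [Finsupp.degree, Finsupp.sum] at *
    exact h (this.trans hf)

theorem truncP_add (k : ℕ) (f f' : MvPolynomial (Fin N) K) :
    truncP k (f + f') = truncP k f + truncP k f' := by
  simp [truncP, Finset.sum_add_distrib]

theorem truncP_mul_X_pow_eq_zero (k : ℕ) (a : Fin N) (f : MvPolynomial (Fin N) K) :
    truncP k (f * X a ^ (k + 1)) = 0 := by
  ext d
  rw [coeff_truncP, X_pow_eq_monomial, coeff_mul_monomial']
  split_ifs with h h'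
  · have h1 := Finsupp.degree_mono h'
    simp only [Finsupp.degree_single] at h1
    omega
  · rfl
  · rfl

theorem truncP_eq_X_of_dvd {k : ℕ} {a : Fin N} {f : MvPolynomial (Fin N) K}
    (h : X a ^ (k + 2) ∣ f - X a) : truncP (k + 1) f = X a := by
  obtain ⟨q, hq⟩ := h
  rw [eq_add_of_sub_eq' hq, truncP_add, mul_comm, truncP_mul_X_pow_eq_zero, add_zero,
    truncP_eq_self (by simp)]

end Truncation

theorem dvd_geom_subst_sub {R : Type*} [CommRing R] (x e : R) (k : ℕ) :
    x ^ (k + 2) ∣ (∑ i ∈ Finset.range (k + 1),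
      e ^ i * (∑ j ∈ Finset.range (k + 1), (-e) ^ j * x ^ (j + 1)) ^ (i + 1)) - x := by
  set q := ∑ j ∈ Finset.range (k + 1), (-e) ^ j * x ^ (j + 1) with hq
  set p := ∑ i ∈ Finset.range (k + 1), e ^ i * q ^ (i + 1) with hp
  have geom : ∀ y a : R, (1 - a * y) * ∑ i ∈ Finset.range (k + 1), a ^ i * y ^ (i + 1) =
      y - a ^ (k + 1) * y ^ (k + 2) := by
    intro y a
    have h := mul_neg_geom_sum (a * y) (k + 1)
    have h2 : ∑ i ∈ Finset.range (k + 1), a ^ i * y ^ (i + 1) =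
        y * ∑ i ∈ Finset.range (k + 1), (a * y) ^ i := by
      rw [Finset.mul_sum]
      exact Finset.sum_congr rfl fun i _ => by ring
    rw [h2, mul_left_comm, h]
    ring
  have h1 := geom x (-e)
  have h2 := geom q e
  rw [← hq] at h1
  rw [← hp] at h2
  have hxq : x ∣ q := Finset.dvd_sum fun j _ =>
    Dvd.dvd.mul_left (dvd_pow_self x j.succ_ne_zero) _
  obtain ⟨r, hr⟩ := pow_dvd_pow_of_dvd hxq (k + 2)
  set y := x ^ (k + 2) with hy
  refine ⟨-(1 + e * x) * e ^ (k + 1) * r - (-e) ^ (k + 1) - p * (e * (-e) ^ (k + 1)), ?_⟩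
  rw [hr] at h2
  linear_combination (1 + e * x) * h2 + (1 + e * p) * h1

section Jets

variable {K : Type} [Field K] {n : ℕ}

theorem JetPair.of_bind₁_eq {k : ℕ} {g h : Fin n → MvPolynomial (Fin n) K}
    (hg : ∀ i, constantCoeff (g i) = 0) (hh : ∀ i, constantCoeff (h i) = 0)
    (hgh : ∀ i, bind₁ h (g i) = X i) (hhg : ∀ i, bind₁ g (h i) = X i) : JetPair K n k g h :=
  ⟨hg, hh, fun i => by rw [hgh, truncP_eq_self (by simp)],
    fun i => by rw [hhg, truncP_eq_self (by simp)]⟩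

/-- The jet of the homographic change `x_a ↦ x_a / (1 - e x_a)` of the coordinate `x_a`. -/
noncomputable def homographicJet (k : ℕ) (e : K) (a : Fin n) : Fin n → MvPolynomial (Fin n) K :=
  Function.update X a (∑ i ∈ Finset.range (k + 1), C e ^ i * X a ^ (i + 1))

theorem constantCoeff_homographicJet (k : ℕ) (e : K) (a i : Fin n) :
    constantCoeff (homographicJet k e a i) = 0 := by
  by_cases h : i = a
  · subst h; simp [homographicJet]
  · simp [homographicJet, h]

theorem truncP_bind₁_homographicJet (k : ℕ) (e : K) (a i : Fin n) :
    truncP (k + 1) (bind₁ (homographicJet k (-e) a) (homographicJet k e a i)) = X i := by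
  by_cases h : i = a
  · subst h
    apply truncP_eq_X_of_dvd
    have hsub : bind₁ (homographicJet k (-e) i) (homographicJet k e i i) =
        ∑ j ∈ Finset.range (k + 1), C e ^ j *
          (∑ l ∈ Finset.range (k + 1), (-C e) ^ l * X i ^ (l + 1)) ^ (j + 1) := by
      simp only [homographicJet, Function.update_self, map_sum, map_mul, map_pow, bind₁_C_right,
        bind₁_X_right, map_neg]
    rw [hsub]
    exact dvd_geom_subst_sub _ _ k
  · simp only [homographicJet, Function.update_of_ne h, bind₁_X_right]
    exact truncP_eq_self (by simp)

theorem jetPair_homographicJet (k : ℕ) (a : Fin n) :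
    JetPair K n k (homographicJet k (-1) a) (homographicJet k 1 a) :=
  ⟨constantCoeff_homographicJet k _ a, constantCoeff_homographicJet k _ a,
    fun i => by simpa using truncP_bind₁_homographicJet k (-1 : K) a i,
    truncP_bind₁_homographicJet k (1 : K) a⟩

theorem jetPair_transvection (k : ℕ) {a b : Fin n} (hab : a ≠ b) :
    JetPair K n k (Function.update X b (X b - X a)) (Function.update X b (X b + X a)) := by
  apply JetPair.of_bind₁_eq
  all_goals
    intro i
    by_cases h : i = b
    · subst h; simp [hab]
    · simp [h]

theorem jetPair_monomial (k : ℕ) (c : Fin n → K) (hc : ∀ i, c i ≠ 0) (π : Equiv.Perm (Fin n)) :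
    JetPair K n k (fun i => C (c (π.symm i))⁻¹ * X (π.symm i)) (fun i => C (c i) * X (π i)) := by
  apply JetPair.of_bind₁_eq
  · simp
  · simp
  · intro i
    simp only [map_mul, bind₁_X_right, ← algebraMap_eq, AlgHom.commutes, Equiv.apply_symm_apply]
    rw [← mul_assoc, ← map_mul, inv_mul_cancel₀ (hc _), map_one, one_mul]
  · intro i
    simp only [map_mul, bind₁_X_right, ← algebraMap_eq, AlgHom.commutes, Equiv.symm_apply_apply]
    rw [← mul_assoc, ← map_mul, mul_inv_cancel₀ (hc _), map_one, one_mul]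

theorem Dmat0_monomial (c : Fin n → K) (π : Equiv.Perm (Fin n)) (i j : Fin n) :
    Dmat0 K n (fun i => C (c i) * X (π i)) i j = if π i = j then c i else 0 := by
  by_cases h : π i = j
  · subst h; simp [Dmat0]
  · simp [Dmat0, h]

end Jets

section DecomposableForms

variable {K : Type} [Field K] {n m : ℕ}

/-- The form `f dℓ_1 ∧ ⋯ ∧ dℓ_m`, depending linearly on `f`. -/
noncomputable def decomposableForm (ℓ : Fin m → MvPolynomial (Fin n) K) :
    MvPolynomial (Fin n) K →ₗ[K] ((Fin m → Fin n) → MvPolynomial (Fin n) K) :=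
  LinearMap.pi fun I => LinearMap.mulRight K
    (Matrix.of fun t s => pderiv (I t) (ℓ s)).det

theorem decomposableForm_apply (ℓ : Fin m → MvPolynomial (Fin n) K) (f : MvPolynomial (Fin n) K)
    (I : Fin m → Fin n) :
    decomposableForm ℓ f I = f * (Matrix.of fun t s => pderiv (I t) (ℓ s)).det := rfl

/-- The value of `dx_{J 0} ∧ ⋯ ∧ dx_{J (m-1)}` on the basis vectors indexed by `I`. -/
def coordMinor (K : Type) [Field K] {n m : ℕ} (I J : Fin m → Fin n) : K :=
  (Matrix.of fun t s => if I t = J s then (1 : K) else 0).det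

theorem decomposableForm_X (J : Fin m → Fin n) (f : MvPolynomial (Fin n) K) (I : Fin m → Fin n) :
    decomposableForm (fun s => X (J s)) f I = f * C (coordMinor K I J) := by
  rw [decomposableForm_apply, coordMinor, RingHom.map_det]
  congr 2
  ext1 t s
  by_cases h : I t = J s <;> simp [pderiv_X, h]

theorem isAltC_decomposableForm (ℓ : Fin m → MvPolynomial (Fin n) K)
    (f : MvPolynomial (Fin n) K) : IsAltC (decomposableForm ℓ f) := by
  intro σ I
  have h := Matrix.det_permute σ (Matrix.of fun t s => pderiv (I t) (ℓ s))
  rw [decomposableForm_apply, decomposableForm_apply, zsmul_eq_mul, mul_left_comm, ← h]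
  rfl

theorem totalDegree_decomposableForm_X_le (J : Fin m → Fin n) (f : MvPolynomial (Fin n) K)
    (I : Fin m → Fin n) :
    (decomposableForm (fun s => X (J s)) f I).totalDegree ≤ f.totalDegree := by
  rw [decomposableForm_X]
  exact (totalDegree_mul _ _).trans (by simp)

theorem decomposableForm_comp_perm (ℓ : Fin m → MvPolynomial (Fin n) K)
    (f : MvPolynomial (Fin n) K) (σ : Equiv.Perm (Fin m)) :
    decomposableForm (fun s => ℓ (σ s)) f =
      ((Equiv.Perm.sign σ : ℤ) : K) • decomposableForm ℓ f := by
  ext1 I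
  have h := Matrix.det_permute' σ (Matrix.of fun t s => pderiv (I t) (ℓ s))
  rw [Pi.smul_apply, decomposableForm_apply, decomposableForm_apply, Int.cast_smul_eq_zsmul,
    zsmul_eq_mul, mul_left_comm, ← h]
  rfl

theorem decomposableForm_eq_zero (ℓ : Fin m → MvPolynomial (Fin n) K)
    (f : MvPolynomial (Fin n) K) {s s' : Fin m} (hs : s ≠ s') (h : ℓ s = ℓ s') :
    decomposableForm ℓ f = 0 := by
  ext1 I
  rw [decomposableForm_apply, Matrix.det_zero_of_column_eq hs (by simp [h]), mul_zero]
  rfl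

theorem decomposableForm_update_add (ℓ : Fin m → MvPolynomial (Fin n) K)
    (f u v : MvPolynomial (Fin n) K) (s : Fin m) :
    decomposableForm (Function.update ℓ s (u + v)) f =
      decomposableForm (Function.update ℓ s u) f + decomposableForm (Function.update ℓ s v) f := by
  ext1 I
  have key : ∀ w, (Matrix.of fun t s' => pderiv (I t) (Function.update ℓ s w s')) =
      (Matrix.of fun t s' => pderiv (I t) (ℓ s')).updateCol s fun t => pderiv (I t) w := by
    intro w
    ext1 t s'
    by_cases h : s' = s
    · subst h; simp
    · simp [h]
  have hadd : (fun t => pderiv (I t) (u + v)) =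
      (fun t => pderiv (I t) u) + fun t => pderiv (I t) v := by
    ext1 t; simp
  simp only [Pi.add_apply, decomposableForm_apply, key, hadd, Matrix.det_updateCol_add, mul_add]

theorem pushForm_decomposableForm_X (k : ℕ) (g h : Fin n → MvPolynomial (Fin n) K)
    (J : Fin m → Fin n) (f : MvPolynomial (Fin n) K) (I : Fin m → Fin n) :
    pushForm K n k m g h (decomposableForm (fun s => X (J s)) f) I =
      truncP k (decomposableForm (fun s => h (J s)) (bind₁ h f) I) := by
  have hrow : (Matrix.of fun t s => pderiv (I t) (h (J s))).det =
      ∑ I' : Fin m → Fin n, (∏ t, pderiv (I t) (h (I' t))) * C (coordMinor K I' J) := by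
    have hmul : (fun t s => pderiv (I t) (h (J s))) = fun t : Fin m => ∑ i : Fin n,
        pderiv (I t) (h i) • fun s : Fin m => C (if i = J s then (1 : K) else 0) := by
      ext1 t
      ext1 s
      simp [Finset.sum_apply, apply_ite]
    rw [hmul]
    let D := (Matrix.detRowAlternating (R := MvPolynomial (Fin n) K) (n := Fin m)).toMultilinearMap
    refine (D.map_sum fun (t : Fin m) (i : Fin n) => pderiv (I t) (h i) •
      fun s : Fin m => C (if i = J s then (1 : K) else 0)).trans
      (Finset.sum_congr rfl fun I' _ => ?_)
    refine (D.map_smul_univ _ _).trans ?_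
    rw [smul_eq_mul, coordMinor, RingHom.map_det]
    rfl
  rw [pushForm, decomposableForm_apply, hrow, Finset.mul_sum]
  congr 1
  refine Finset.sum_congr rfl fun I' _ => ?_
  rw [decomposableForm_X, map_mul, bind₁_C_right]
  ring

theorem decomposableForm_C_mul (c : Fin m → K) (ℓ : Fin m → MvPolynomial (Fin n) K)
    (f : MvPolynomial (Fin n) K) :
    decomposableForm (fun s => C (c s) * ℓ s) f = (∏ s, c s) • decomposableForm ℓ f := by
  ext1 I
  have h := Matrix.det_mul_row (fun s => C (c s)) (Matrix.of fun t s => pderiv (I t) (ℓ s))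
  simp only [Matrix.of_apply] at h
  simp only [Pi.smul_apply, decomposableForm_apply, pderiv_C_mul, smul_eq_C_mul, map_prod]
  rw [h]
  ring

/-- An alternating family of components is a combination of the forms `f dx_J`. -/
theorem factorial_smul_eq_sum_decomposableForm {ω : (Fin m → Fin n) → MvPolynomial (Fin n) K}
    (hω : IsAltC ω) :
    ((m.factorial : ℕ) : K) • ω =
      ∑ J : Fin m → Fin n, decomposableForm (fun s => X (J s)) (ω J) := by
  ext1 I
  have hminor : ∀ J : Fin m → Fin n, coordMinor K I J =
      ∑ σ : Equiv.Perm (Fin m), ((Equiv.Perm.sign σ : ℤ) : K) * if I ∘ σ = J then 1 else 0 := by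
    intro J
    rw [coordMinor, Matrix.det_apply']
    refine Finset.sum_congr rfl fun σ _ => ?_
    simp only [Matrix.of_apply, Finset.prod_ite_zero, Finset.prod_const_one, funext_iff,
      Finset.mem_univ, true_imp_iff, Function.comp_apply]
  simp only [Finset.sum_apply, decomposableForm_X, hminor, map_sum, Finset.mul_sum]
  rw [Finset.sum_comm]
  have hterm : ∀ σ : Equiv.Perm (Fin m), ∑ J : Fin m → Fin n,
      ω J * C (((Equiv.Perm.sign σ : ℤ) : K) * if I ∘ σ = J then 1 else 0) = ω I := by
    intro σ
    rw [Finset.sum_eq_single (I ∘ σ) (fun J _ hJ => by simp [hJ.symm]) (by simp), hω σ I]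
    rcases Int.units_eq_one_or (Equiv.Perm.sign σ) with h | h <;> simp [h]
  simp only [hterm, Finset.sum_const, Finset.card_univ, Fintype.card_perm, Fintype.card_fin,
    Pi.smul_apply, Nat.cast_smul_eq_nsmul]

end DecomposableForms

section NaturalOperations

variable {K : Type} [Field K] {n m k : ℕ}

/-- Compatibility of `δ` with the action of the `(k+1)`-jets of diffeomorphisms fixing `0`. -/
def IsNaturalOperation (k : ℕ)
    (δ : ((Fin m → Fin n) → MvPolynomial (Fin n) K) →ₗ[K] ((Fin (m + 1) → Fin n) → K)) : Prop :=
  ∀ g h : Fin n → MvPolynomial (Fin n) K, JetPair K n k g h →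
    ∀ ω : (Fin m → Fin n) → MvPolynomial (Fin n) K,
      IsAltC ω → (∀ i, (ω i).totalDegree ≤ k) →
      δ (pushForm K n k m g h ω) = fun I => ∑ I' : Fin (m + 1) → Fin n,
        (∏ t, Dmat0 K n h (I' t) (I t)) * δ ω I'

/-- The values of `δ` on the forms `x_{P 0} dx_{P 1} ∧ ⋯ ∧ dx_{P m}`. -/
noncomputable def linearPart
    (δ : ((Fin m → Fin n) → MvPolynomial (Fin n) K) →ₗ[K] ((Fin (m + 1) → Fin n) → K))
    (P : Fin (m + 1) → Fin n) : (Fin (m + 1) → Fin n) → K :=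
  δ (decomposableForm (fun s => X (P s.succ)) (X (P 0)))

variable {δ : ((Fin m → Fin n) → MvPolynomial (Fin n) K) →ₗ[K] ((Fin (m + 1) → Fin n) → K)}

namespace IsNaturalOperation

theorem apply_decomposableForm (hδ : IsNaturalOperation k δ)
    {g h : Fin n → MvPolynomial (Fin n) K} (hgh : JetPair K n k g h) (J : Fin m → Fin n)
    {f : MvPolynomial (Fin n) K} (hf : f.totalDegree ≤ k)
    (hdeg : ∀ I, (decomposableForm (fun s => h (J s)) (bind₁ h f) I).totalDegree ≤ k) :
    δ (decomposableForm (fun s => h (J s)) (bind₁ h f)) =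
      fun I => ∑ I' : Fin (m + 1) → Fin n, (∏ t, Dmat0 K n h (I' t) (I t)) *
        δ (decomposableForm (fun s => X (J s)) f) I' := by
  rw [← hδ g h hgh _ (isAltC_decomposableForm _ _)
    fun I => (totalDegree_decomposableForm_X_le J f I).trans hf]
  congr 1
  ext1 I
  rw [pushForm_decomposableForm_X, truncP_eq_self (hdeg I)]

theorem monomial_change (hδ : IsNaturalOperation k δ) (c : Fin n → K) (hc : ∀ i, c i ≠ 0)
    (π : Equiv.Perm (Fin n)) (J : Fin m → Fin n) {f : MvPolynomial (Fin n) K}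
    (hf : f.totalDegree ≤ k)
    (hf' : (bind₁ (fun i => C (c i) * X (π i)) f).totalDegree ≤ k) (I : Fin (m + 1) → Fin n) :
    (∏ s, c (J s)) * δ (decomposableForm (fun s => X (π (J s)))
        (bind₁ (fun i => C (c i) * X (π i)) f)) I =
      (∏ t, c (π.symm (I t))) * δ (decomposableForm (fun s => X (J s)) f) (π.symm ∘ I) := by
  have hsplit := decomposableForm_C_mul (fun s => c (J s)) (fun s => X (π (J s)))
    (bind₁ (fun i => C (c i) * X (π i)) f)
  have h := congrFun (hδ.apply_decomposableForm (jetPair_monomial k c hc π) J hf fun I' => by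
    rw [hsplit]
    exact (totalDegree_smul_le _ _).trans
      ((totalDegree_decomposableForm_X_le (fun s => π (J s)) _ I').trans hf')) I
  rw [hsplit, map_smul, Pi.smul_apply, smul_eq_mul] at h
  rw [h, Finset.sum_eq_single (π.symm ∘ I)]
  · simp [Dmat0_monomial]
  · intro I' _ hI'
    obtain ⟨t, ht⟩ := Function.ne_iff.1 hI'
    rw [Finset.prod_eq_zero (Finset.mem_univ t), zero_mul]
    rw [Dmat0_monomial, if_neg]
    intro h
    exact ht (by simp [← h])
  · simp

theorem apply_monomial_eq_zero [CharZero K] (hδ : IsNaturalOperation k δ) (J : Fin m → Fin n)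
    {d : Fin n →₀ ℕ} (hd : d.degree ≤ k) (hd1 : d.degree ≠ 1) :
    δ (decomposableForm (fun s => X (J s)) (monomial d 1)) = 0 := by
  have hbind : bind₁ (fun i => C (2 : K) * X ((1 : Equiv.Perm (Fin n)) i)) (monomial d 1) =
      (2 : K) ^ d.degree • monomial d (1 : K) := by
    rw [bind₁_monomial, monomial_eq, C_1, one_mul, one_mul, smul_eq_C_mul]
    simp only [Equiv.Perm.one_apply, mul_pow, Finset.prod_mul_distrib, Finset.prod_pow_eq_pow_sum,
      C_pow]
    rfl
  have hdeg : (monomial d (1 : K)).totalDegree ≤ k := by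
    rw [totalDegree_monomial _ one_ne_zero]
    exact hd
  ext I
  have h := hδ.monomial_change (fun _ => 2) (by simp) 1 J hdeg
    (by rw [hbind]; exact (totalDegree_smul_le _ _).trans hdeg) I
  rw [hbind, map_smul, map_smul] at h
  simp only [Finset.prod_const, Finset.card_univ, Fintype.card_fin, Pi.smul_apply, smul_eq_mul,
    Equiv.Perm.one_apply] at h
  have hne : (2 : K) ^ m * 2 ^ d.degree ≠ 2 ^ (m + 1) := by
    rw [← pow_add]
    norm_cast
    intro h
    have := Nat.pow_right_injective le_rfl h
    omega
  rw [← mul_assoc] at h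
  by_contra h0
  exact hne (mul_right_cancel₀ h0 h)

theorem linearPart_monomial_change (hδ : IsNaturalOperation k δ) (hk : 1 ≤ k) (c : Fin n → K)
    (hc : ∀ i, c i ≠ 0) (π : Equiv.Perm (Fin n)) (P I : Fin (m + 1) → Fin n) :
    (∏ t, c (P t)) * linearPart δ (π ∘ P) I =
      (∏ t, c (π.symm (I t))) * linearPart δ P (π.symm ∘ I) := by
  have hbind : bind₁ (fun i => C (c i) * X (π i)) (X (P 0)) = c (P 0) • X (π (P 0)) := by
    rw [bind₁_X_right, smul_eq_C_mul]
  have h := hδ.monomial_change c hc π (fun s => P s.succ) (f := X (P 0)) (by simpa using hk)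
    (by rw [hbind]; exact (totalDegree_smul_le _ _).trans (by simpa using hk)) I
  rw [hbind, map_smul, map_smul, Pi.smul_apply, smul_eq_mul] at h
  rw [Fin.prod_univ_succ, mul_comm (c _), mul_assoc]
  exact h

theorem linearPart_perm (hδ : IsNaturalOperation k δ) (hk : 1 ≤ k)
    (π : Equiv.Perm (Fin n)) (P I : Fin (m + 1) → Fin n) :
    linearPart δ (π ∘ P) (π ∘ I) = linearPart δ P I := by
  have h := hδ.linearPart_monomial_change hk (fun _ => 1) (by simp) π P (π ∘ I)
  simpa [← Function.comp_assoc] using h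

theorem linearPart_eq_zero_of_forall_perm [CharZero K] (hδ : IsNaturalOperation k δ) (hk : 1 ≤ k)
    {P I : Fin (m + 1) → Fin n} (hP : Function.Injective P)
    (hI : ∀ σ : Equiv.Perm (Fin (m + 1)), I ≠ P ∘ σ) : linearPart δ P I = 0 := by
  by_contra h0
  have hcount : ∀ a, (Finset.univ.filter fun t => P t = a).card =
      (Finset.univ.filter fun t => I t = a).card := by
    intro a
    have h := hδ.linearPart_monomial_change hk (fun i => if i = a then 2 else 1)
      (fun i => by split_ifs <;> simp) 1 P I
    have h2 := mul_right_cancel₀ h0 h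
    simp only [Finset.prod_ite, Finset.prod_const, one_pow, mul_one] at h2
    exact Nat.pow_right_injective le_rfl (by exact_mod_cast h2)
  have hle : ∀ a, (Finset.univ.filter fun t => I t = a).card ≤ 1 := by
    intro a
    rw [← hcount, Finset.card_le_one]
    intro s hs t ht
    simp only [Finset.mem_filter, Finset.mem_univ, true_and] at hs ht
    exact hP (hs.trans ht.symm)
  have hIinj : Function.Injective I := by
    intro s t hst
    exact Finset.card_le_one.1 (hle (I t)) s (by simpa using hst) t (by simp)
  have hex : ∀ t, ∃ s, P s = I t := by
    intro t
    have hpos : 0 < (Finset.univ.filter fun s => P s = I t).card := by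
      rw [hcount, Finset.card_pos]
      exact ⟨t, by simp⟩
    obtain ⟨s, hs⟩ := Finset.card_pos.1 hpos
    exact ⟨s, by simpa using hs⟩
  choose σ hσ using hex
  have hσinj : Function.Injective σ := fun s t hst => hIinj (by rw [← hσ, ← hσ, hst])
  exact hI (Equiv.ofBijective σ (Finite.injective_iff_bijective.1 hσinj))
    (funext fun t => (hσ t).symm)

theorem apply_X_eq_zero_of_mem [CharZero K] (hδ : IsNaturalOperation k δ) (hk : 1 ≤ k)
    {J : Fin m → Fin n} (hJ : Function.Injective J) (s : Fin m) :
    δ (decomposableForm (fun s => X (J s)) (X (J s))) = 0 := by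
  set a := J s with ha
  set f : MvPolynomial (Fin n) K :=
    ∑ i ∈ Finset.range (k + 1), ((i + 1 : ℕ) : K) • monomial (Finsupp.single a i) 1 with hf
  have hform : decomposableForm (fun t => homographicJet k (1 : K) a (J t)) 1 =
      decomposableForm (fun t => X (J t)) f := by
    ext1 I
    rw [decomposableForm_apply, decomposableForm_apply, one_mul]
    have hmat : (Matrix.of fun t r => pderiv (I t) (homographicJet k (1 : K) a (J r))) =
        Matrix.of fun t r => (Function.update (fun _ => 1) s f : Fin m → MvPolynomial (Fin n) K) r *
          pderiv (I t) (X (J r)) := by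
      ext1 t r
      by_cases hr : r = s
      · subst hr
        simp only [Matrix.of_apply, homographicJet, ← ha, Function.update_self, map_one, one_pow,
          one_mul, map_sum, pderiv_pow, hf, Finset.sum_mul]
        refine Finset.sum_congr rfl fun i _ => ?_
        rw [← X_pow_eq_monomial, smul_eq_C_mul]
        simp
      · have hne : J r ≠ a := fun h => hr (hJ h)
        simp [homographicJet, hr, hne]
    rw [hmat]
    refine (Matrix.det_mul_row _ (Matrix.of fun t r => pderiv (I t) (X (J r)))).trans ?_
    congr 1
    simp [Finset.prod_update_of_mem]
  have hfdeg : f.totalDegree ≤ k := by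
    refine totalDegree_finsetSum_le fun i hi => (totalDegree_smul_le _ _).trans ?_
    rw [totalDegree_monomial _ one_ne_zero]
    simpa [Nat.lt_succ_iff] using hi
  have hone : δ (decomposableForm (fun t => X (J t)) 1) = 0 := by
    simpa using hδ.apply_monomial_eq_zero J (d := 0) (by simp) (by simp)
  have h := hδ.apply_decomposableForm (jetPair_homographicJet k a) J (f := 1) (by simp)
    fun I => by
      rw [map_one, hform]
      exact (totalDegree_decomposableForm_X_le J f I).trans hfdeg
  simp only [map_one, hform, hone, Pi.zero_apply, mul_zero, Finset.sum_const_zero] at h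
  rw [hf, map_sum, map_sum, Finset.sum_eq_single 1] at h
  · rw [map_smul, map_smul] at h
    have h2 := (smul_eq_zero.1 h).resolve_left (by norm_num)
    exact h2
  · intro i hi hi1
    rw [map_smul, map_smul, hδ.apply_monomial_eq_zero J (by simpa [Nat.lt_succ_iff] using hi)
      (by simpa using hi1), smul_zero]
  · intro h1
    simp at h1
    omega

theorem linearPart_comp_swap_zero [CharZero K] (hδ : IsNaturalOperation k δ) (hk : 1 ≤ k)
    {P : Fin (m + 1) → Fin n} (hP : Function.Injective P) (s : Fin m) :
    linearPart δ (P ∘ Equiv.swap 0 s.succ) = -linearPart δ P := by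
  set a := P 0 with ha
  set b := P s.succ with hb
  have hab : a ≠ b := fun h => (Fin.succ_ne_zero s).symm (hP h)
  have hJ : Function.Injective fun t : Fin m => P t.succ :=
    hP.comp (Fin.succ_injective m)
  have htail : ∀ t : Fin m, (P ∘ Equiv.swap 0 s.succ) t.succ =
      Function.update (fun t : Fin m => P t.succ) s a t := by
    intro t
    by_cases h : t = s
    · subst h; simp [ha]
    · simp [h, Equiv.swap_apply_of_ne_of_ne (Fin.succ_ne_zero t)
        (fun h' => h (Fin.succ_injective m h'))]
  have hJ' : Function.Injective (Function.update (fun t : Fin m => P t.succ) s a) := by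
    have h := (hP.comp (Equiv.swap 0 s.succ).injective).comp (Fin.succ_injective m)
    rwa [show (P ∘ Equiv.swap 0 s.succ) ∘ Fin.succ = _ from funext htail] at h
  set ℓ : Fin m → MvPolynomial (Fin n) K := fun t => X (P t.succ) with hℓ
  have hb_form : Function.update ℓ s (X b) = ℓ := Function.update_eq_self s ℓ
  have ha_form : Function.update ℓ s (X a) =
      fun t => X (Function.update (fun t : Fin m => P t.succ) s a t) := by
    ext1 t
    by_cases h : t = s
    · subst h; simp
    · simp [h, hℓ]
  have hpull : (fun t : Fin m => (Function.update X b (X b + X a) :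
      Fin n → MvPolynomial (Fin n) K) (P t.succ)) = Function.update ℓ s (X b + X a) := by
    ext1 t
    by_cases h : t = s
    · subst h; simp [hb]
    · have hne : P t.succ ≠ b := fun h' => h (hJ h')
      simp [h, hne, hℓ]
  have hbind : bind₁ (Function.update X b (X b + X a)) (X b) =
      (X b + X a : MvPolynomial (Fin n) K) := by simp
  have hlin : (X b + X a : MvPolynomial (Fin n) K).totalDegree ≤ k :=
    (totalDegree_add _ _).trans (by simpa using hk)
  have h := hδ.apply_decomposableForm (jetPair_transvection k hab) (fun t : Fin m => P t.succ)
    (f := X b) (by simpa using hk) fun I => by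
      rw [hpull, hbind, decomposableForm_update_add, hb_form, ha_form]
      exact (totalDegree_add _ _).trans (max_le
        ((totalDegree_decomposableForm_X_le _ _ I).trans hlin)
        ((totalDegree_decomposableForm_X_le _ _ I).trans hlin))
  have h1 : δ (decomposableForm ℓ (X b)) = 0 := hδ.apply_X_eq_zero_of_mem hk hJ s
  have h2 := hδ.apply_X_eq_zero_of_mem hk hJ' s
  rw [Function.update_self] at h2
  rw [hpull, hbind, decomposableForm_update_add, hb_form, ha_form, map_add, map_add, map_add,
    map_add, map_add, h1, h2, zero_add, add_zero] at h
  simp only [Pi.zero_apply, mul_zero, Finset.sum_const_zero] at h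
  have hswap : linearPart δ (P ∘ Equiv.swap 0 s.succ) = δ (decomposableForm
      (fun t => X (Function.update (fun t : Fin m => P t.succ) s a t)) (X b)) := by
    simp only [linearPart, htail]
    simp [hb]
  rw [hswap]
  exact eq_neg_of_add_eq_zero_right h

theorem linearPart_comp_swap [CharZero K] (hδ : IsNaturalOperation k δ) (hk : 1 ≤ k)
    {P : Fin (m + 1) → Fin n} (hP : Function.Injective P) {x y : Fin (m + 1)} (hxy : x ≠ y) :
    linearPart δ (P ∘ Equiv.swap x y) = -linearPart δ P := by
  cases x using Fin.cases with
  | zero =>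
    cases y using Fin.cases with
    | zero => exact absurd rfl hxy
    | succ j => exact hδ.linearPart_comp_swap_zero hk hP j
  | succ i =>
    cases y using Fin.cases with
    | zero =>
      rw [Equiv.swap_comm]
      exact hδ.linearPart_comp_swap_zero hk hP i
    | succ j =>
      have hij : i ≠ j := fun h => hxy (congrArg _ h)
      have hhead : Equiv.swap i.succ j.succ (0 : Fin (m + 1)) = 0 :=
        Equiv.swap_apply_of_ne_of_ne (Fin.succ_ne_zero i).symm (Fin.succ_ne_zero j).symm
      have htail : ∀ t : Fin m, Equiv.swap i.succ j.succ t.succ = (Equiv.swap i j t).succ :=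
        fun t => (Fin.succ_injective m).swap_apply i j t
      simp only [linearPart, Function.comp_apply, hhead, htail]
      rw [decomposableForm_comp_perm (fun t : Fin m => X (P t.succ)) _ (Equiv.swap i j),
        Equiv.Perm.sign_swap hij]
      simp

theorem linearPart_comp_perm [CharZero K] (hδ : IsNaturalOperation k δ) (hk : 1 ≤ k)
    (σ : Equiv.Perm (Fin (m + 1))) {P : Fin (m + 1) → Fin n} (hP : Function.Injective P) :
    linearPart δ (P ∘ σ) = ((Equiv.Perm.sign σ : ℤ) : K) • linearPart δ P := by
  induction σ using Equiv.Perm.swap_induction_on generalizing P with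
  | one => simp
  | swap_mul f x y hxy ih =>
    have h := ih (P := P ∘ Equiv.swap x y) (hP.comp (Equiv.injective _))
    rw [hδ.linearPart_comp_swap hk hP hxy] at h
    rw [Equiv.Perm.coe_mul, ← Function.comp_assoc, h, Equiv.Perm.sign_mul,
      Equiv.Perm.sign_swap hxy]
    simp

theorem exists_linearPart_eq [CharZero K] (hδ : IsNaturalOperation k δ) (hk : 1 ≤ k) :
    ∃ c : K, ∀ P I : Fin (m + 1) → Fin n, linearPart δ P I = c * coordMinor K I P := by
  have hnoninj : ∀ P I : Fin (m + 1) → Fin n, ¬ Function.Injective P →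
      linearPart δ P I = 0 ∧ coordMinor K I P = 0 := by
    intro P I hP
    constructor
    · by_cases hJ : Function.Injective fun t : Fin m => P t.succ
      · obtain ⟨s, hs⟩ : ∃ s : Fin m, P s.succ = P 0 := by
          by_contra! hne
          apply hP
          have h := Fin.cons_injective_iff.2 ⟨fun ⟨s, hs⟩ => hne s hs, hJ⟩
          rwa [show Fin.cons (P 0) (fun t : Fin m => P t.succ) = P from
            Fin.cons_self_tail P] at h
        rw [linearPart, ← hs, hδ.apply_X_eq_zero_of_mem hk hJ s, Pi.zero_apply]
      · obtain ⟨s, s', h, hs⟩ : ∃ s s' : Fin m, P s.succ = P s'.succ ∧ s ≠ s' := by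
          simpa [Function.Injective] using hJ
        rw [linearPart, decomposableForm_eq_zero _ _ hs (by rw [h]), map_zero, Pi.zero_apply]
    · obtain ⟨s, s', h, hs⟩ : ∃ s s', P s = P s' ∧ s ≠ s' := by
        simpa [Function.Injective] using hP
      exact Matrix.det_zero_of_column_eq hs (by simp [h])
  by_cases hex : ∃ P₀ : Fin (m + 1) → Fin n, Function.Injective P₀
  · obtain ⟨P₀, hP₀⟩ := hex
    refine ⟨linearPart δ P₀ P₀, fun P I => ?_⟩
    by_cases hP : Function.Injective P
    · by_cases hI : ∃ σ : Equiv.Perm (Fin (m + 1)), I = P ∘ σ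
      · obtain ⟨σ, rfl⟩ := hI
        have hdiag : linearPart δ P P = linearPart δ P₀ P₀ := by
          obtain ⟨π, hπ⟩ := Equiv.Perm.exists_extending_pair P₀ P hP₀ hP
          rw [show P = π ∘ P₀ from funext fun t => (hπ t).symm, hδ.linearPart_perm hk]
        have hminor : coordMinor K (P ∘ σ) P = ((Equiv.Perm.sign σ : ℤ) : K) := by
          have h := Matrix.det_permute σ (1 : Matrix (Fin (m + 1)) (Fin (m + 1)) K)
          rw [Matrix.det_one, mul_one] at h
          rw [coordMinor, ← h]
          congr 1
          ext1 t s
          simp [Matrix.one_apply, hP.eq_iff]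
        have hval := congrFun (hδ.linearPart_comp_perm hk σ hP) (P ∘ σ)
        have hσdiag : linearPart δ (P ∘ σ) (P ∘ σ) = linearPart δ P P := by
          obtain ⟨π, hπ⟩ := Equiv.Perm.exists_extending_pair P (P ∘ σ) hP (hP.comp σ.injective)
          rw [show P ∘ σ = π ∘ P from funext fun t => (hπ t).symm, hδ.linearPart_perm hk]
        rw [hσdiag, hdiag, Pi.smul_apply, smul_eq_mul] at hval
        rw [hminor, hval]
        rcases Int.units_eq_one_or (Equiv.Perm.sign σ) with h | h <;> simp [h]
      · push Not at hI
        rw [hδ.linearPart_eq_zero_of_forall_perm hk hP hI, coordMinor, Matrix.det_apply',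
          Finset.sum_eq_zero, mul_zero]
        intro σ _
        obtain ⟨t, ht⟩ := Function.ne_iff.1 (hI σ.symm)
        rw [Finset.prod_eq_zero (Finset.mem_univ (σ.symm t)), mul_zero]
        simpa using ht
    · rw [(hnoninj P I hP).1, (hnoninj P I hP).2, mul_zero]
  · push Not at hex
    exact ⟨0, fun P I => by rw [(hnoninj P I (hex P)).1, zero_mul]⟩

end IsNaturalOperation

/-- The linear map `ω ↦ (dω)(0)`. -/
noncomputable def extdAtZero (K : Type) [Field K] (n m : ℕ) :
    ((Fin m → Fin n) → MvPolynomial (Fin n) K) →ₗ[K] ((Fin (m + 1) → Fin n) → K) where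
  toFun ω I := constantCoeff (extd ω I)
  map_add' ω ω' := by
    ext1 I
    simp [extd, Finset.sum_add_distrib]
  map_smul' r ω := by
    ext1 I
    simp [extd, Finset.mul_sum, mul_left_comm]

theorem extdAtZero_decomposableForm (J : Fin m → Fin n) (f : MvPolynomial (Fin n) K)
    (I : Fin (m + 1) → Fin n) :
    extdAtZero K n m (decomposableForm (fun s => X (J s)) f) I =
      ∑ t : Fin (m + 1), (-1) ^ (t : ℕ) *
        (constantCoeff (pderiv (I t) f) * coordMinor K (I ∘ t.succAbove) J) := by
  change constantCoeff (extd _ I) = _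
  simp [extd, decomposableForm_X, mul_comm]

theorem extdAtZero_monomial_eq_zero (J : Fin m → Fin n) {d : Fin n →₀ ℕ} (hd : d.degree ≠ 1) :
    extdAtZero K n m (decomposableForm (fun s => X (J s)) (monomial d 1)) = 0 := by
  ext1 I
  rw [extdAtZero_decomposableForm]
  refine Finset.sum_eq_zero fun t _ => ?_
  rw [pderiv_monomial, constantCoeff_monomial]
  split_ifs with h
  · by_cases h0 : d (I t) = 0
    · simp [h0]
    · exfalso
      apply hd
      have hle : Finsupp.single (I t) 1 ≤ d := by
        rw [Finsupp.single_le_iff]; omega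
      rw [← tsub_add_cancel_of_le hle, h]
      simp
  · simp

theorem extdAtZero_X (P I : Fin (m + 1) → Fin n) :
    extdAtZero K n m (decomposableForm (fun s => X (P s.succ)) (X (P 0))) I =
      coordMinor K I P := by
  rw [extdAtZero_decomposableForm (fun s => P s.succ), coordMinor, Matrix.det_succ_column_zero]
  refine Finset.sum_congr rfl fun t _ => ?_
  rw [mul_assoc]
  congr 2
  by_cases h : I t = P 0
  · simp [h]
  · simp [h, pderiv_X_of_ne (Ne.symm h)]

end NaturalOperations

/-- **Schouten's theorem for differential forms.** Every natural linear operation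
`δ : Ω^m_{≤k} → Λ^{m+1}(K^n)^*` (i.e. `δ(g·ω) = δ(ω) ∘ (Dg(0)⁻¹)^{×(m+1)}` for every
`(k+1)`-jet `g` of a diffeomorphism fixing `0`) is a scalar multiple of `ω ↦ (dω)(0)`. -/
theorem schouten_for_forms (K : Type) [Field K] [CharZero K]
    (n m k : ℕ) (hn : 1 ≤ n) (hm : m ≤ n)
    (δ : ((Fin m → Fin n) → MvPolynomial (Fin n) K) →ₗ[K] ((Fin (m + 1) → Fin n) → K))
    (hnat : ∀ g h : Fin n → MvPolynomial (Fin n) K, JetPair K n k g h →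
      ∀ ω : (Fin m → Fin n) → MvPolynomial (Fin n) K,
        IsAltC ω → (∀ i, (ω i).totalDegree ≤ k) →
        δ (pushForm K n k m g h ω) = fun I => ∑ I' : Fin (m + 1) → Fin n,
          (∏ t, Dmat0 K n h (I' t) (I t)) * δ ω I') :
    ∃ c : K, ∀ ω : (Fin m → Fin n) → MvPolynomial (Fin n) K,
      IsAltC ω → (∀ i, (ω i).totalDegree ≤ k) →
      δ ω = fun I => c * constantCoeff (extd ω I) := by
  have hδ : IsNaturalOperation k δ := hnat
  obtain ⟨c, hc⟩ : ∃ c : K, ∀ (J : Fin m → Fin n) (d : Fin n →₀ ℕ), d.degree ≤ k →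
      δ (decomposableForm (fun s => X (J s)) (monomial d 1)) =
        c • extdAtZero K n m (decomposableForm (fun s => X (J s)) (monomial d 1)) := by
    by_cases hk : 1 ≤ k
    · obtain ⟨c, hc⟩ := hδ.exists_linearPart_eq hk
      refine ⟨c, fun J d hd => ?_⟩
      by_cases hd1 : d.degree = 1
      · obtain ⟨a, rfl⟩ : d ∈ Set.range fun a => Finsupp.single a 1 := by
          rw [Finsupp.range_single_one]
          exact hd1
        ext1 I
        have hlin := hc (Fin.cons a J) I
        rw [← extdAtZero_X] at hlin
        simpa [linearPart, X] using hlin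
      · rw [hδ.apply_monomial_eq_zero J hd hd1, extdAtZero_monomial_eq_zero J hd1, smul_zero]
    · refine ⟨0, fun J d hd => ?_⟩
      rw [hδ.apply_monomial_eq_zero J hd (by omega), zero_smul]
  have hform : ∀ (J : Fin m → Fin n) (f : MvPolynomial (Fin n) K), f.totalDegree ≤ k →
      δ (decomposableForm (fun s => X (J s)) f) =
        c • extdAtZero K n m (decomposableForm (fun s => X (J s)) f) := by
    intro J f hf
    rw [f.as_sum]
    simp only [map_sum, Finset.smul_sum]
    refine Finset.sum_congr rfl fun d hd => ?_
    rw [← mul_one (coeff d f), ← smul_eq_mul, ← smul_monomial, map_smul, map_smul, map_smul,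
      hc J d ((le_totalDegree hd).trans hf), smul_comm]
  refine ⟨c, fun ω hω hdeg => ?_⟩
  change δ ω = c • extdAtZero K n m ω
  have hsum := factorial_smul_eq_sum_decomposableForm hω
  have hfac : ((m.factorial : ℕ) : K) ≠ 0 := Nat.cast_ne_zero.2 m.factorial_ne_zero
  apply smul_right_injective _ hfac
  change ((m.factorial : ℕ) : K) • δ ω = ((m.factorial : ℕ) : K) • (c • extdAtZero K n m ω)
  rw [smul_comm _ c, ← map_smul, ← map_smul, hsum, map_sum, map_sum, Finset.smul_sum]
  exact Finset.sum_congr rfl fun J _ => hform J _ (hdeg J)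
end
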